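/- arXiv:1807.10905 — 2 statements merged into one kernel-verified Lean document; each statement's English description precedes it below -/
import Mathlib

section
/- Let n ≥ 3 and let H be a bounded harmonic function on {x ∈ ℝⁿ : |x| > 2}. Then there exist a constant c ∈ ℝ and, for every integer k ≥ 0, a harmonic homogeneous polynomial p_k of degree k on ℝⁿ, such that for every x with |x| > 2 the series Σ_{k=0}^∞ |x|^{2−n−2k} p_k(x) converges absolutely and H(x) = c + Σ_{k=0}^∞ |x|^{2−n−2k} p_k(x). (In spherical-harmonic notation this is H = c + Σ_k c_k r^{−k−(n−2)} G_k, since r^{−k−(n−2)} G_k(ω) = |x|^{2−n−2k} p_k(x).) -/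
open Real
open scoped BigOperators

noncomputable section

abbrev E (n : ℕ) := EuclideanSpace ℝ (Fin n)

/-- The Euclidean Laplacian of `f` at `x` (sum of second partial derivatives). -/
def lap (n : ℕ) (f : E n → ℝ) (x : E n) : ℝ :=
  ∑ i : Fin n, fderiv ℝ (fun y => fderiv ℝ f y (EuclideanSpace.single i 1)) x
    (EuclideanSpace.single i 1)

/-- `f` is a (real) polynomial function on `ℝⁿ`. -/
def IsPolyFun (n : ℕ) (f : E n → ℝ) : Prop :=
  ∃ P : MvPolynomial (Fin n) ℝ, ∀ x : E n, f x = MvPolynomial.eval (fun i => x i) P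

/-- `p` is a harmonic homogeneous polynomial of degree `m` on `ℝⁿ`. -/
def IsHHP (n m : ℕ) (p : E n → ℝ) : Prop :=
  IsPolyFun n p ∧ (∀ (c : ℝ) (x : E n), p (c • x) = c ^ m * p x) ∧ ∀ x : E n, lap n p x = 0

/-- The `i`-th partial derivative of `f`. -/
def pd {n : ℕ} (i : Fin n) (f : E n → ℝ) (x : E n) : ℝ :=
  fderiv ℝ f x (EuclideanSpace.single i 1)

section Calculus

open MeasureTheory

variable {n : ℕ} {f g : E n → ℝ} {x : E n} {i : Fin n}

lemma lap_eq_sum_pd (f : E n → ℝ) (x : E n) : lap n f x = ∑ i, pd i (pd i f) x := rfl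

lemma ContDiff.pd (hf : ContDiff ℝ 2 f) (i : Fin n) : ContDiff ℝ 1 (pd i f) :=
  (hf.fderiv_right (m := 1) (by norm_num)).clm_apply contDiff_const

lemma ContDiff.continuous_pd (hf : ContDiff ℝ 1 f) (i : Fin n) : Continuous (_root_.pd i f) :=
  (hf.continuous_fderiv (by norm_num)).clm_apply continuous_const

lemma continuous_lap (hf : ContDiff ℝ 2 f) : Continuous (lap n f) :=
  continuous_finsetSum _ fun i _ => (hf.pd i).continuous_pd i

lemma pd_congr (h : f =ᶠ[nhds x] g) : pd i f x = pd i g x := by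
  simp only [pd, h.fderiv_eq]

lemma pd_eventuallyEq (h : f =ᶠ[nhds x] g) : pd i f =ᶠ[nhds x] pd i g :=
  h.eventually_nhds.mono fun _ hy => pd_congr hy

lemma lap_congr (h : f =ᶠ[nhds x] g) : lap n f x = lap n g x :=
  Finset.sum_congr rfl fun _ _ => pd_congr (pd_eventuallyEq h)

lemma lap_zero (x : E n) : lap n (fun _ => (0 : ℝ)) x = 0 := by
  simp [lap]

lemma pd_add (hf : DifferentiableAt ℝ f x) (hg : DifferentiableAt ℝ g x) :
    pd i (fun y => f y + g y) x = pd i f x + pd i g x := by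
  simp [pd, fderiv_fun_add hf hg]

lemma pd_mul (hf : DifferentiableAt ℝ f x) (hg : DifferentiableAt ℝ g x) :
    pd i (fun y => f y * g y) x = f x * pd i g x + g x * pd i f x := by
  simp [pd, fderiv_fun_mul hf hg]

lemma pd_const_mul (hf : DifferentiableAt ℝ f x) (c : ℝ) :
    pd i (fun y => c * f y) x = c * pd i f x := by
  simp [pd, fderiv_const_mul hf]

lemma lap_add (hf : ContDiff ℝ 2 f) (hg : ContDiff ℝ 2 g) (x : E n) :
    lap n (fun y => f y + g y) x = lap n f x + lap n g x := by
  simp only [lap_eq_sum_pd, ← Finset.sum_add_distrib]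
  refine Finset.sum_congr rfl fun i _ => ?_
  rw [← pd_add ((hf.pd i).differentiable (by norm_num) x) ((hg.pd i).differentiable (by norm_num) x)]
  congr 1
  ext y
  exact pd_add (hf.differentiable (by norm_num) y) (hg.differentiable (by norm_num) y)

lemma lap_const_mul (hf : ContDiff ℝ 2 f) (c : ℝ) (x : E n) :
    lap n (fun y => c * f y) x = c * lap n f x := by
  simp only [lap_eq_sum_pd, Finset.mul_sum]
  refine Finset.sum_congr rfl fun i _ => ?_
  rw [← pd_const_mul ((hf.pd i).differentiable (by norm_num) x)]
  congr 1
  ext y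
  exact pd_const_mul (hf.differentiable (by norm_num) y) c

lemma lap_sub (hf : ContDiff ℝ 2 f) (hg : ContDiff ℝ 2 g) (x : E n) :
    lap n (fun y => f y - g y) x = lap n f x - lap n g x := by
  have := lap_add hf ((contDiff_const (c := (-1 : ℝ))).mul hg) x
  rw [lap_const_mul hg] at this
  simp only [neg_one_mul, ← sub_eq_add_neg] at this
  exact this

lemma lap_sum {ι : Type*} (s : Finset ι) (F : ι → E n → ℝ) (hF : ∀ j, ContDiff ℝ 2 (F j))
    (x : E n) : lap n (fun y => ∑ j ∈ s, F j y) x = ∑ j ∈ s, lap n (F j) x := by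
  classical
  induction s using Finset.induction_on with
  | empty => simp [lap_zero]
  | insert a s ha ih =>
    simp only [Finset.sum_insert ha, ← ih]
    exact lap_add (hF a) (ContDiff.sum fun j _ => hF j) x

lemma lap_mul (hf : ContDiff ℝ 2 f) (hg : ContDiff ℝ 2 g) (x : E n) :
    lap n (fun y => f y * g y) x
      = f x * lap n g x + 2 * ∑ i, pd i f x * pd i g x + g x * lap n f x := by
  simp only [lap_eq_sum_pd, Finset.mul_sum, ← Finset.sum_add_distrib]
  refine Finset.sum_congr rfl fun i _ => ?_
  have hf0 := hf.differentiable (by norm_num)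
  have hg0 := hg.differentiable (by norm_num)
  have hf1 := (hf.pd i).differentiable (by norm_num)
  have hg1 := (hg.pd i).differentiable (by norm_num)
  have : pd i (fun y => f y * g y) = fun y => f y * pd i g y + g y * pd i f y := by
    ext y
    exact pd_mul (hf0 y) (hg0 y)
  rw [this, pd_add (DifferentiableAt.fun_mul (hf0 x) (hg1 x))
    (DifferentiableAt.fun_mul (hg0 x) (hf1 x)), pd_mul (hf0 x) (hg1 x),
    pd_mul (hg0 x) (hf1 x)]
  ring

lemma integral_mul_pd (hf : ContDiff ℝ 1 f) (hg : ContDiff ℝ 1 g)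
    (h : HasCompactSupport f ∨ HasCompactSupport g) (i : Fin n) :
    ∫ x, f x * pd i g x = - ∫ x, pd i f x * g x := by
  have key : ∀ {u v : E n → ℝ}, Continuous u → Continuous v →
      (HasCompactSupport u ∨ HasCompactSupport v) → Integrable (fun x => u x * v x) := by
    intro u v hu hv h
    refine (hu.mul hv).integrable_of_hasCompactSupport ?_
    rcases h with h | h
    · exact h.mul_right
    · exact h.mul_left
  refine integral_mul_fderiv_eq_neg_fderiv_mul_of_integrable ?_ ?_ ?_
    (fun x _ => hf.differentiable (by norm_num) x) (fun x _ => hg.differentiable (by norm_num) x)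
  · exact key (hf.continuous_pd i) hg.continuous (h.imp_left fun h => h.fderiv_apply ℝ _)
  · exact key hf.continuous (hg.continuous_pd i) (h.imp_right fun h => h.fderiv_apply ℝ _)
  · exact key hf.continuous hg.continuous h

lemma hasCompactSupport_pd (hf : HasCompactSupport f) (i : Fin n) : HasCompactSupport (pd i f) :=
  hf.fderiv_apply ℝ _

/-- Green's second identity on the whole space. -/
lemma integral_mul_lap (hf : ContDiff ℝ 2 f) (hg : ContDiff ℝ 2 g)
    (h : HasCompactSupport f ∨ HasCompactSupport g) :
    ∫ x, f x * lap n g x = ∫ x, g x * lap n f x := by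
  have key : ∀ {u v : E n → ℝ}, Continuous u → Continuous v →
      (HasCompactSupport u ∨ HasCompactSupport v) → Integrable (fun x => u x * v x) := by
    intro u v hu hv h
    refine (hu.mul hv).integrable_of_hasCompactSupport ?_
    rcases h with h | h
    · exact h.mul_right
    · exact h.mul_left
  simp only [lap_eq_sum_pd, Finset.mul_sum]
  rw [integral_finsetSum _ fun i _ => key hf.continuous ((hg.pd i).continuous_pd i)
      (h.imp_right fun h => hasCompactSupport_pd (hasCompactSupport_pd h i) i),
    integral_finsetSum _ fun i _ => key hg.continuous ((hf.pd i).continuous_pd i)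
      (h.symm.imp_right fun h => hasCompactSupport_pd (hasCompactSupport_pd h i) i)]
  refine Finset.sum_congr rfl fun i _ => ?_
  rw [integral_mul_pd (hf.of_le (by norm_num)) (hg.pd i)
      (h.imp_right fun h => hasCompactSupport_pd h i),
    integral_mul_pd (hg.of_le (by norm_num)) (hf.pd i)
      (h.symm.imp_right fun h => hasCompactSupport_pd h i)]
  simp only [mul_comm]

lemma pd_radial {φ φ' : ℝ → ℝ} (h : ∀ t, 0 ≤ t → HasDerivAt φ (φ' t) t) (c : E n) :
    pd i (fun y => φ (‖y - c‖ ^ 2)) x = φ' (‖x - c‖ ^ 2) * (2 * (x i - c i)) := by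
  have h1 : HasFDerivAt (fun y : E n => ‖y - c‖ ^ 2) _ x :=
    ((hasFDerivAt_id x).sub_const c).norm_sq
  have := ((h (‖x - c‖ ^ 2) (by positivity)).comp_hasFDerivAt x h1).fderiv
  simp only [Function.comp_def] at this
  rw [pd, this]
  simp [EuclideanSpace.inner_single_right]

lemma pd_coord (c : E n) : pd i (fun y => 2 * (y i - c i)) x = 2 := by
  have : HasFDerivAt (fun y : E n => 2 * (y i - c i)) _ x :=
    (((EuclideanSpace.proj i : E n →L[ℝ] ℝ).hasFDerivAt (x := x)).sub_const
      (c i)).const_mul 2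
  rw [pd, this.fderiv]
  simp

lemma differentiableAt_radial {φ φ' : ℝ → ℝ} (h : ∀ t, 0 ≤ t → HasDerivAt φ (φ' t) t) (c : E n) :
    DifferentiableAt ℝ (fun y => φ (‖y - c‖ ^ 2)) x :=
  DifferentiableAt.comp x (h (‖x - c‖ ^ 2) (by positivity)).differentiableAt
    (((hasFDerivAt_id x).sub_const c).norm_sq).differentiableAt

/-- The Laplacian of a radial function. -/
lemma lap_radial {φ φ' φ'' : ℝ → ℝ} (h : ∀ t, 0 ≤ t → HasDerivAt φ (φ' t) t)
    (h' : ∀ t, 0 ≤ t → HasDerivAt φ' (φ'' t) t) (c x : E n) :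
    lap n (fun y => φ (‖y - c‖ ^ 2)) x
      = 2 * n * φ' (‖x - c‖ ^ 2) + 4 * ‖x - c‖ ^ 2 * φ'' (‖x - c‖ ^ 2) := by
  have key (i : Fin n) : pd i (pd i fun y => φ (‖y - c‖ ^ 2)) x
      = 2 * φ' (‖x - c‖ ^ 2) + 4 * φ'' (‖x - c‖ ^ 2) * (x i - c i) ^ 2 := by
    have h1 : (pd i fun y => φ (‖y - c‖ ^ 2))
        = fun y : E n => φ' (‖y - c‖ ^ 2) * (2 * (y i - c i)) := by
      ext y
      exact pd_radial h c
    rw [h1, pd_mul (differentiableAt_radial h' c) (by fun_prop), pd_coord, pd_radial h']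
    ring
  rw [lap_eq_sum_pd, Finset.sum_congr rfl fun i _ => key i, Finset.sum_add_distrib,
    ← Finset.mul_sum (f := fun i => (x i - c i) ^ 2)]
  have : ∑ i, (x i - c i) ^ 2 = ‖x - c‖ ^ 2 := by
    rw [EuclideanSpace.norm_sq_eq]
    simp
  rw [this]
  simp
  ring

end Calculus

/-- Gegenbauer polynomials with parameter `l`, homogenized: `b ^ (k / 2) * C_k^l (a / √b)`. -/
def gegenbauer (l a b : ℝ) : ℕ → ℝ
  | 0 => 1
  | 1 => 2 * l * a
  | k + 2 => (2 * (k + 1 + l) * a * gegenbauer l a b (k + 1)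
      - (k + 2 * l) * b * gegenbauer l a b k) / (k + 2)

/-- The exponent `(n - 2) / 2`. -/
def lam (n : ℕ) : ℝ := ((n : ℝ) - 2) / 2

/-- Zonal solid harmonics: the coefficients in the expansion of `‖x - y‖ ^ (2 - n)`. -/
def zonal (n k : ℕ) (x y : E n) : ℝ :=
  gegenbauer (lam n) (inner ℝ x y) (‖x‖ ^ 2 * ‖y‖ ^ 2) k

section Zonal

variable {n : ℕ}

lemma zonal_zero (x y : E n) : zonal n 0 x y = 1 := by simp [zonal, gegenbauer]

lemma zonal_one (x y : E n) : zonal n 1 x y = 2 * lam n * inner ℝ x y := by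
  simp [zonal, gegenbauer]

lemma zonal_add_two (k : ℕ) (x y : E n) :
    zonal n (k + 2) x y = (2 * (k + 1 + lam n) / (k + 2)) * (inner ℝ x y * zonal n (k + 1) x y)
      - ((k + 2 * lam n) / (k + 2) * ‖y‖ ^ 2) * (‖x‖ ^ 2 * zonal n k x y) := by
  simp only [zonal, gegenbauer]
  ring

lemma zonal_symm (k : ℕ) (x y : E n) : zonal n k x y = zonal n k y x := by
  simp only [zonal, real_inner_comm x y, mul_comm (‖x‖ ^ 2)]

lemma zonal_smul (k : ℕ) (c : ℝ) (x y : E n) : zonal n k (c • x) y = c ^ k * zonal n k x y := by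
  induction k using Nat.twoStepInduction with
  | zero => simp [zonal_zero]
  | one => simp only [zonal_one, real_inner_smul_left]; ring
  | more k h1 h2 =>
    simp only [zonal_add_two, h1, h2, real_inner_smul_left, norm_smul, mul_pow, norm_eq_abs,
      sq_abs]
    ring

/-- `zonal n k` is a polynomial in both variables. -/
lemma exists_zonal_eq_eval (n k : ℕ) :
    ∃ Q : MvPolynomial (Fin n) (MvPolynomial (Fin n) ℝ), ∀ x y : E n, zonal n k x y
      = MvPolynomial.eval (fun i => x i)
          (MvPolynomial.map (MvPolynomial.eval fun i => y i) Q) := by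
  have hinner (x y : E n) : inner ℝ x y = ∑ i, x i * y i := by
    simp [PiLp.inner_apply, mul_comm]
  have hnorm (x : E n) : ‖x‖ ^ 2 = ∑ i, x i * x i := by
    rw [EuclideanSpace.norm_sq_eq]
    simp [sq]
  induction k using Nat.twoStepInduction with
  | zero => exact ⟨1, by simp [zonal_zero]⟩
  | one =>
    refine ⟨.C (.C (2 * lam n)) * ∑ i, .X i * .C (.X i), fun x y => ?_⟩
    simp [zonal_one, hinner]
  | more k h1 h2 =>
    obtain ⟨Q1, h1⟩ := h1
    obtain ⟨Q2, h2⟩ := h2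
    refine ⟨.C (.C (2 * (k + 1 + lam n) / (k + 2))) * ((∑ i, .X i * .C (.X i)) * Q2)
      - .C (.C ((k + 2 * lam n) / (k + 2)) * ∑ i, .X i * .X i) * ((∑ i, .X i * .X i) * Q1),
      fun x y => ?_⟩
    simp [zonal_add_two, hinner, hnorm, h1, h2]

lemma contDiff_inner_const (y : E n) {m : WithTop ℕ∞} :
    ContDiff ℝ m fun x : E n => (inner ℝ x y : ℝ) :=
  contDiff_id.inner ℝ contDiff_const

lemma contDiff_zonal_left (k : ℕ) (y : E n) {m : WithTop ℕ∞} :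
    ContDiff ℝ m fun x => zonal n k x y := by
  induction k using Nat.twoStepInduction with
  | zero => simp only [zonal_zero]; fun_prop
  | one => simp only [zonal_one]; exact contDiff_const.mul (contDiff_inner_const y)
  | more k h1 h2 =>
    simp only [zonal_add_two]
    exact (contDiff_const.mul ((contDiff_inner_const y).mul h2)).sub
      (contDiff_const.mul ((contDiff_norm_sq ℝ).mul h1))

lemma contDiff_zonal_right (k : ℕ) (x : E n) {m : WithTop ℕ∞} : ContDiff ℝ m (zonal n k x) := by
  have : zonal n k x = fun y => zonal n k y x := funext fun y => zonal_symm k x y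
  rw [this]
  exact contDiff_zonal_left k x

lemma pd_inner_left (i : Fin n) (x y : E n) : pd i (fun x => inner ℝ x y) x = y i := by
  have h : (fun x : E n => (inner ℝ x y : ℝ)) = fun x => inner ℝ y x := by
    ext z
    exact real_inner_comm _ _
  have hd : HasFDerivAt (fun x : E n => (inner ℝ y x : ℝ)) (innerSL ℝ y) x :=
    (innerSL ℝ y).hasFDerivAt
  rw [pd, h, hd.fderiv]
  simp [EuclideanSpace.inner_single_right]

lemma pd_norm_sq (i : Fin n) (x : E n) : pd i (fun x => ‖x‖ ^ 2) x = 2 * x i := by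
  have := pd_radial (i := i) (x := x) (φ := id) (φ' := fun _ => 1) (fun t _ => hasDerivAt_id t) 0
  simpa using this

lemma lap_norm_sq (x : E n) : lap n (fun x => ‖x‖ ^ 2) x = 2 * n := by
  have := lap_radial (φ := id) (φ' := fun _ => 1) (φ'' := fun _ => 0) (fun t _ => hasDerivAt_id t)
    (fun t _ => hasDerivAt_const t 1) 0 x
  simpa using this

lemma lap_inner_left (x y : E n) : lap n (fun x => inner ℝ x y) x = 0 := by
  rw [lap_eq_sum_pd]
  refine Finset.sum_eq_zero fun i _ => ?_
  rw [show pd i (fun x : E n => (inner ℝ x y : ℝ)) = fun _ => y i from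
    funext fun x => pd_inner_left i x y]
  simp [pd]

lemma pd_zonal_add_two (k : ℕ) (i : Fin n) (x y : E n) :
    pd i (fun x => zonal n (k + 2) x y) x
      = (2 * (k + 1 + lam n) / (k + 2)) * (inner ℝ x y * pd i (fun x => zonal n (k + 1) x y) x
          + zonal n (k + 1) x y * y i)
        - ((k + 2 * lam n) / (k + 2) * ‖y‖ ^ 2) * (‖x‖ ^ 2 * pd i (fun x => zonal n k x y) x
          + zonal n k x y * (2 * x i)) := by
  have d (k : ℕ) : DifferentiableAt ℝ (fun x => zonal n k x y) x :=
    (contDiff_zonal_left k y (m := 1)).differentiable (by norm_num) x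
  have d1 : DifferentiableAt ℝ (fun x : E n => (inner ℝ x y : ℝ)) x :=
      (contDiff_inner_const y (m := 1)).differentiable (by norm_num) x
  have d2 : DifferentiableAt ℝ (fun x : E n => ‖x‖ ^ 2) x :=
    (contDiff_norm_sq ℝ (n := 1)).differentiable (by norm_num) x
  simp only [zonal_add_two, sub_eq_add_neg, ← neg_mul]
  rw [pd_add ((d1.fun_mul (d (k + 1))).const_mul _) ((d2.fun_mul (d k)).const_mul _),
    pd_const_mul (d1.fun_mul (d (k + 1))), pd_const_mul (d2.fun_mul (d k)), pd_mul d1 (d (k + 1)),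
    pd_mul d2 (d k), pd_inner_left, pd_norm_sq]

/-- Euler's identity for zonal harmonics. -/
lemma sum_mul_pd_zonal (k : ℕ) (x y : E n) :
    ∑ i, x i * pd i (fun x => zonal n k x y) x = k * zonal n k x y := by
  have hn : ∑ i, x i * x i = ‖x‖ ^ 2 := by
    rw [EuclideanSpace.norm_sq_eq]
    simp [sq]
  have hi : ∑ i, x i * y i = inner ℝ x y := by
    simp [PiLp.inner_apply, mul_comm]
  induction k using Nat.twoStepInduction with
  | zero => simp [zonal_zero, pd]
  | one =>
    have d1 : DifferentiableAt ℝ (fun x : E n => (inner ℝ x y : ℝ)) x :=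
      (contDiff_inner_const y (m := 1)).differentiable (by norm_num) x
    simp only [zonal_one, pd_const_mul d1, pd_inner_left, ← hi, Finset.mul_sum]
    refine Finset.sum_congr rfl fun i _ => ?_
    push_cast
    ring
  | more k h1 h2 =>
    have e (i : Fin n) : x i * pd i (fun x => zonal n (k + 2) x y) x
        = (2 * (k + 1 + lam n) / (k + 2)) *
            (inner ℝ x y * (x i * pd i (fun x => zonal n (k + 1) x y) x)
              + zonal n (k + 1) x y * (x i * y i))
          - ((k + 2 * lam n) / (k + 2) * ‖y‖ ^ 2) *
            (‖x‖ ^ 2 * (x i * pd i (fun x => zonal n k x y) x)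
              + zonal n k x y * (2 * (x i * x i))) := by
      rw [pd_zonal_add_two]
      ring
    simp only [e, Finset.sum_sub_distrib, ← Finset.mul_sum, Finset.sum_add_distrib, h1, h2, hn, hi]
    rw [zonal_add_two]
    push_cast
    ring

lemma sum_mul_pd_zonal_succ (k : ℕ) (x y : E n) :
    ∑ i, y i * pd i (fun x => zonal n (k + 1) x y) x
      = (k + 2 * lam n) * ‖y‖ ^ 2 * zonal n k x y := by
  have hn : ∑ i, y i * y i = ‖y‖ ^ 2 := by
    rw [EuclideanSpace.norm_sq_eq]
    simp [sq]
  have hi : ∑ i, y i * x i = inner ℝ x y := by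
    simp [PiLp.inner_apply]
  have e (k : ℕ) (i : Fin n) : y i * pd i (fun x => zonal n (k + 2) x y) x
      = (2 * (k + 1 + lam n) / (k + 2)) *
          (inner ℝ x y * (y i * pd i (fun x => zonal n (k + 1) x y) x)
            + zonal n (k + 1) x y * (y i * y i))
        - ((k + 2 * lam n) / (k + 2) * ‖y‖ ^ 2) *
          (‖x‖ ^ 2 * (y i * pd i (fun x => zonal n k x y) x)
            + zonal n k x y * (2 * (y i * x i))) := by
    rw [pd_zonal_add_two]
    ring
  have h0 : ∑ i, y i * pd i (fun x => zonal n (0 + 1) x y) x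
      = ((0 : ℕ) + 2 * lam n) * ‖y‖ ^ 2 * zonal n 0 x y := by
    have d1 : DifferentiableAt ℝ (fun x : E n => (inner ℝ x y : ℝ)) x :=
      (contDiff_inner_const y (m := 1)).differentiable (by norm_num) x
    simp only [zero_add, zonal_one, zonal_zero, pd_const_mul d1, pd_inner_left, ← hn,
      Finset.mul_sum, Finset.sum_mul]
    refine Finset.sum_congr rfl fun i _ => ?_
    push_cast
    ring
  induction k using Nat.twoStepInduction with
  | zero => exact h0
  | one =>
    have e0 := e 0
    simp only [zero_add] at e0 h0
    simp only [Nat.reduceAdd, e0, Finset.sum_sub_distrib, ← Finset.mul_sum,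
      Finset.sum_add_distrib, h0, hn, hi]
    simp only [zonal_zero, zonal_one, pd, fderiv_fun_const]
    simp
    ring
  | more k h1 h2 =>
    rw [Finset.sum_congr rfl fun i _ => e (k + 1) i]
    simp only [Finset.sum_sub_distrib, ← Finset.mul_sum, Finset.sum_add_distrib, h1, h2, hn, hi]
    rw [zonal_add_two]
    have : (k : ℝ) + 1 + 2 ≠ 0 := by positivity
    have : (k : ℝ) + 2 ≠ 0 := by positivity
    push_cast
    field_simp
    ring

lemma lap_zonal (k : ℕ) (x y : E n) : lap n (fun x => zonal n k x y) x = 0 := by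
  induction k using Nat.twoStepInduction with
  | zero => simp only [zonal_zero]; simp [lap]
  | one =>
    simp only [zonal_one]
    rw [lap_const_mul (contDiff_inner_const y), lap_inner_left, mul_zero]
  | more k h1 h2 =>
    have c (k : ℕ) : ContDiff ℝ 2 (fun x => zonal n k x y) := contDiff_zonal_left k y
    have c1 : ContDiff ℝ 2 (fun x : E n => (inner ℝ x y : ℝ)) := contDiff_inner_const y
    have c2 : ContDiff ℝ 2 (fun x : E n => ‖x‖ ^ 2) := contDiff_norm_sq ℝ
    simp only [zonal_add_two]
    rw [lap_sub (contDiff_const.mul (c1.mul (c _))) (contDiff_const.mul (c2.mul (c _))),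
      lap_const_mul (c1.mul (c _)), lap_const_mul (c2.mul (c _)), lap_mul c1 (c _),
      lap_mul c2 (c _), h1, h2, lap_inner_left, lap_norm_sq]
    simp only [pd_inner_left, pd_norm_sq, mul_assoc (2 : ℝ), ← Finset.mul_sum, sum_mul_pd_zonal,
      sum_mul_pd_zonal_succ]
    have : (k : ℝ) + 2 ≠ 0 := by positivity
    simp only [lam]
    field_simp
    ring

end Zonal

/-- The coefficients of the power series of `(1 - t) ^ (-l)`. -/
def binCoeff (l : ℝ) : ℕ → ℝ
  | 0 => 1
  | j + 1 => (l + j) / (j + 1) * binCoeff l j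

lemma binCoeff_nonneg {l : ℝ} (hl : 0 ≤ l) (j : ℕ) : 0 ≤ binCoeff l j := by
  induction j with
  | zero => simp [binCoeff]
  | succ j ih => rw [binCoeff]; positivity

lemma binCoeff_eq_choose (l : ℝ) (j : ℕ) :
    (binCoeff l j : ℂ) = Ring.choose ((l : ℂ) + j - 1) j := by
  have h : (binCoeff l j : ℂ) = Ring.multichoose (l : ℂ) j := by
    have hf : (j.factorial : ℂ) ≠ 0 := by exact_mod_cast j.factorial_ne_zero
    refine mul_left_cancel₀ hf ?_
    rw [← nsmul_eq_mul _ (Ring.multichoose (l : ℂ) j),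
      Ring.factorial_nsmul_multichoose_eq_ascPochhammer]
    clear hf
    induction j with
    | zero => simp [binCoeff]
    | succ j ih =>
      have : (j : ℂ) + 1 ≠ 0 := by exact_mod_cast j.succ_ne_zero
      rw [ascPochhammer_succ_right, Polynomial.smeval_mul, ← ih, binCoeff, Nat.factorial_succ]
      simp [Polynomial.smeval_add, Polynomial.smeval_natCast]
      field_simp
  rw [h, Ring.choose]
  congr 1
  ring

lemma hasSum_binCoeff (l : ℝ) {u : ℂ} (hu : ‖u‖ < 1) :
    HasSum (fun j => (binCoeff l j : ℂ) * u ^ j) (1 / (1 - u) ^ (l : ℂ)) := by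
  have := (Complex.one_div_one_sub_cpow_hasFPowerSeriesOnBall_zero (l : ℂ)).hasSum (y := u)
    (by simpa [enorm_eq_nnnorm, ← NNReal.coe_lt_one] using hu)
  simpa [binCoeff_eq_choose, FormalMultilinearSeries.ofScalars_apply_eq, mul_comm] using this

lemma summable_binCoeff (l : ℝ) {r : ℝ} (h0 : 0 ≤ r) (h1 : r < 1) :
    Summable fun j => binCoeff l j * r ^ j := by
  have := (hasSum_binCoeff l (u := r) (by simpa [abs_of_nonneg h0] using h1)).summable
  exact_mod_cast this

open PowerSeries in
lemma gegenbauer_eq_sum (l a b : ℝ) {α β : ℂ} (hadd : α + β = 2 * a) (hmul : α * β = b) (k : ℕ) :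
    (gegenbauer l a b k : ℂ) = ∑ p ∈ Finset.HasAntidiagonal.antidiagonal k,
      (binCoeff l p.1 * α ^ p.1) * (binCoeff l p.2 * β ^ p.2) := by
  let A (z : ℂ) : PowerSeries ℂ := mk fun j => binCoeff l j * z ^ j
  have hA (z : ℂ) : derivative ℂ (A z) = C z * (X * derivative ℂ (A z)) + C (l * z) * A z := by
    ext j
    have e : ((j : ℂ) + 1) * (binCoeff l (j + 1) : ℂ) = (l + j) * binCoeff l j := by
      have : (j : ℂ) + 1 ≠ 0 := by exact_mod_cast j.succ_ne_zero
      rw [binCoeff]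
      push_cast
      field_simp
    have lhs : coeff j (derivative ℂ (A z)) = (l + j) * binCoeff l j * z ^ (j + 1) := by
      rw [coeff_derivative, ← e]
      simp [A]
      ring
    rw [lhs]
    cases j with
    | zero => simp [A]; ring
    | succ j =>
      rw [map_add, coeff_C_mul, coeff_succ_X_mul, coeff_derivative, coeff_C_mul]
      simp [A]
      ring
  set P := A α * A β with hP
  have hode : derivative ℂ P = C (2 * a : ℂ) * (X * derivative ℂ P)
      - C (b : ℂ) * (X * (X * derivative ℂ P)) + C (l * (2 * a) : ℂ) * P
      - C (2 * l * b : ℂ) * (X * P) := by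
    have hd : derivative ℂ P = A α * derivative ℂ (A β) + A β * derivative ℂ (A α) := by
      simp [hP, Derivation.leibniz]
    have h1 := hA α
    have h2 := hA β
    rw [hd, ← hadd, ← hmul]
    simp only [map_mul] at h1 h2
    simp only [map_add, map_mul, hP]
    have h3 : (C (2 : ℂ) : PowerSeries ℂ) = 2 := map_ofNat _ 2
    rw [h3]
    linear_combination (1 - C α * X) * A α * h2 + (1 - C β * X) * A β * h1
  have hcoeff (k : ℕ) : ((k : ℂ) + 2) * coeff (k + 2) P
      = 2 * (k + 1 + l) * a * coeff (k + 1) P - (k + 2 * l) * b * coeff k P := by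
    have := congrArg (coeff (k + 1)) hode
    cases k with
    | zero =>
      simp only [map_add, map_sub, coeff_C_mul, coeff_succ_X_mul, coeff_derivative,
        coeff_zero_X_mul] at this
      push_cast at *
      linear_combination this
    | succ k =>
      simp only [map_add, map_sub, coeff_C_mul, coeff_succ_X_mul, coeff_derivative] at this
      push_cast at *
      linear_combination this
  suffices (gegenbauer l a b k : ℂ) = coeff k P by
    rw [this, hP, coeff_mul]
    simp [A]
  induction k using Nat.twoStepInduction with
  | zero => simp [gegenbauer, hP, A, binCoeff]
  | one =>
    rw [hP, coeff_mul]
    simp [gegenbauer, A, binCoeff, Finset.Nat.antidiagonal_succ]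
    linear_combination (-l : ℂ) * hadd
  | more k h1 h2 =>
    have : (k : ℂ) + 2 ≠ 0 := by exact_mod_cast (k + 1).succ_ne_zero
    rw [gegenbauer]
    push_cast
    rw [h1, h2, ← hcoeff]
    field_simp

section Generating

variable {n : ℕ}

lemma exists_conj_roots (x y : E n) : ∃ α : ℂ, ‖α‖ = ‖x‖ * ‖y‖ ∧ α.re = inner ℝ x y := by
  have h : (inner ℝ x y) ^ 2 ≤ (‖x‖ * ‖y‖) ^ 2 := by
    rw [← sq_abs]
    gcongr
    exact abs_real_inner_le_norm x y
  refine ⟨⟨inner ℝ x y, √((‖x‖ * ‖y‖) ^ 2 - (inner ℝ x y) ^ 2)⟩, ?_, rfl⟩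
  rw [Complex.norm_def, Complex.normSq_mk, Real.mul_self_sqrt (by linarith)]
  rw [← sq, add_sub_cancel, Real.sqrt_sq (by positivity)]

/-- Majorant for the expansion of the fundamental solution. -/
def zonalBound (n : ℕ) (r : ℝ) (k : ℕ) : ℝ :=
  ∑ p ∈ Finset.HasAntidiagonal.antidiagonal k, (binCoeff (lam n) p.1 * r ^ p.1) * (binCoeff (lam n) p.2 * r ^ p.2)

lemma lam_pos (hn : 3 ≤ n) : 0 < lam n := by
  have : (3 : ℝ) ≤ n := by exact_mod_cast hn
  unfold lam
  linarith

lemma summable_zonalBound {r : ℝ} (h0 : 0 ≤ r) (h1 : r < 1) :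
    Summable (zonalBound n r) := by
  have h := summable_binCoeff (lam n) h0 h1
  have := (summable_norm_sum_mul_antidiagonal_of_summable_norm h.norm h.norm).of_norm
  unfold zonalBound
  exact this

lemma abs_zonal_le (hn : 3 ≤ n) {r : ℝ} {x y : E n} (hx : x ≠ 0) (hy : ‖y‖ ≤ r * ‖x‖) (k : ℕ) :
    |(‖x‖ ^ 2)⁻¹ ^ k * zonal n k x y| ≤ zonalBound n r k := by
  have hx' : 0 < ‖x‖ := norm_pos_iff.2 hx
  obtain ⟨α, hα, hre⟩ := exists_conj_roots x y
  have hb := binCoeff_nonneg (lam_pos hn).le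
  have hs : ‖α‖ / ‖x‖ ^ 2 ≤ r := by
    rw [hα, div_le_iff₀ (by positivity)]
    nlinarith
  have h := gegenbauer_eq_sum (lam n) (inner ℝ x y) (‖x‖ ^ 2 * ‖y‖ ^ 2) (α := α)
    (β := (starRingEnd ℂ) α) (by rw [Complex.add_conj, hre]; push_cast; ring)
    (by rw [Complex.mul_conj, Complex.normSq_eq_norm_sq, hα]; push_cast; ring) k
  rw [abs_mul, ← norm_eq_abs (zonal n k x y), zonal, ← Complex.norm_real, h, zonalBound,
    abs_of_nonneg (by positivity)]
  calc (‖x‖ ^ 2)⁻¹ ^ k * _ ≤ (‖x‖ ^ 2)⁻¹ ^ k * ∑ p ∈ Finset.HasAntidiagonal.antidiagonal k,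
        (binCoeff (lam n) p.1 * ‖α‖ ^ p.1) * (binCoeff (lam n) p.2 * ‖α‖ ^ p.2) := by
        gcongr
        refine (norm_sum_le _ _).trans (Finset.sum_le_sum fun p _ => ?_)
        simp [abs_of_nonneg (hb _)]
    _ = ∑ p ∈ Finset.HasAntidiagonal.antidiagonal k, (binCoeff (lam n) p.1 * (‖α‖ / ‖x‖ ^ 2) ^ p.1) *
          (binCoeff (lam n) p.2 * (‖α‖ / ‖x‖ ^ 2) ^ p.2) := by
        rw [Finset.mul_sum]
        refine Finset.sum_congr rfl fun p hp => ?_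
        rw [← Finset.HasAntidiagonal.mem_antidiagonal.1 hp, div_eq_mul_inv]
        ring
    _ ≤ _ := by
        refine Finset.sum_le_sum fun p _ => ?_
        have hr : 0 ≤ r := (by positivity : 0 ≤ ‖α‖ / ‖x‖ ^ 2).trans hs
        have := hb p.1
        have := hb p.2
        gcongr

/-- Expansion of the fundamental solution in zonal harmonics. -/
lemma hasSum_zonal {x y : E n} (h : ‖y‖ < ‖x‖) :
    HasSum (fun k : ℕ => (‖x‖ ^ 2)⁻¹ ^ k * zonal n k x y)
      (‖x‖ ^ (2 * lam n) * (‖x - y‖ ^ 2) ^ (-lam n)) := by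
  have hx' : 0 < ‖x‖ := (norm_nonneg y).trans_lt h
  have hx : x ≠ 0 := norm_pos_iff.1 hx'
  obtain ⟨α, hα, hre⟩ := exists_conj_roots x y
  set u : ℂ := α / (‖x‖ ^ 2 : ℝ) with hu
  have hun : ‖u‖ < 1 := by
    rw [hu, norm_div, hα, Complex.norm_real, norm_of_nonneg (by positivity),
      div_lt_one (by positivity)]
    nlinarith
  have hun' : ‖(starRingEnd ℂ) u‖ < 1 := by rwa [RCLike.norm_conj]
  have hG (k : ℕ) : (((‖x‖ ^ 2)⁻¹ ^ k * zonal n k x y : ℝ) : ℂ) = ∑ p ∈ Finset.HasAntidiagonal.antidiagonal k,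
      (binCoeff (lam n) p.1 * u ^ p.1) * (binCoeff (lam n) p.2 * (starRingEnd ℂ) u ^ p.2) := by
    have h := gegenbauer_eq_sum (lam n) (inner ℝ x y) (‖x‖ ^ 2 * ‖y‖ ^ 2) (α := α)
      (β := (starRingEnd ℂ) α) (by rw [Complex.add_conj, hre]; push_cast; ring)
      (by rw [Complex.mul_conj, Complex.normSq_eq_norm_sq, hα]; push_cast; ring) k
    rw [Complex.ofReal_mul, zonal, h, Finset.mul_sum]
    refine Finset.sum_congr rfl fun p hp => ?_
    rw [← Finset.HasAntidiagonal.mem_antidiagonal.1 hp, hu, map_div₀, Complex.conj_ofReal, div_eq_mul_inv,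
      div_eq_mul_inv]
    push_cast
    ring
  have hs1 := hasSum_binCoeff (lam n) hun
  have hs2 := hasSum_binCoeff (lam n) hun'
  have hval : 1 / (1 - u) ^ ((lam n : ℝ) : ℂ) * (1 / (1 - (starRingEnd ℂ) u) ^ ((lam n : ℝ) : ℂ))
      = ((‖x‖ ^ (2 * lam n) * (‖x - y‖ ^ 2) ^ (-lam n) : ℝ) : ℂ) := by
    have hre1 : 0 < (1 - u).re := by
      have := (Complex.re_le_norm u).trans_lt hun
      simpa using this
    have harg : (1 - u).arg ≠ π := by
      intro hh
      rw [Complex.arg_eq_pi_iff] at hh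
      linarith [hh.1]
    have e1 : (1 - (starRingEnd ℂ) u) ^ ((lam n : ℝ) : ℂ)
        = (starRingEnd ℂ) ((1 - u) ^ ((lam n : ℝ) : ℂ)) := by
      have h1 : 1 - (starRingEnd ℂ) u = (starRingEnd ℂ) (1 - u) := by simp
      rw [h1, Complex.conj_cpow_eq_ite, if_neg harg, Complex.conj_ofReal]
    have hne : (1 - u) ≠ 0 := by
      intro hh
      simp [hh] at hre1
    have e2 : ‖(1 - u) ^ ((lam n : ℝ) : ℂ)‖ = ‖1 - u‖ ^ lam n :=
      Complex.norm_cpow_real _ _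
    have e3 : ‖1 - u‖ ^ 2 = ‖x - y‖ ^ 2 / ‖x‖ ^ 2 := by
      have hure : u.re = inner ℝ x y / ‖x‖ ^ 2 := by
        rw [hu, Complex.div_ofReal_re, hre]
      have hunorm : ‖u‖ ^ 2 = ‖y‖ ^ 2 / ‖x‖ ^ 2 := by
        rw [hu, norm_div, hα, Complex.norm_real, norm_of_nonneg (by positivity)]
        field_simp
      have : ‖1 - u‖ ^ 2 = 1 - 2 * u.re + ‖u‖ ^ 2 := by
        rw [← Complex.normSq_eq_norm_sq, ← Complex.normSq_eq_norm_sq, Complex.normSq_sub]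
        simp
        ring
      rw [this, hure, hunorm, norm_sub_sq_real]
      field_simp
    rw [e1, ← mul_div_mul_comm, one_mul, Complex.mul_conj, Complex.normSq_eq_norm_sq, e2]
    norm_cast
    rw [← Real.rpow_natCast, ← Real.rpow_mul (norm_nonneg _), mul_comm, Real.rpow_mul (norm_nonneg _),
      Real.rpow_natCast, e3, Real.div_rpow (by positivity) (by positivity), Real.rpow_neg (by positivity),
      Real.rpow_mul (norm_nonneg _)]
    norm_cast
    rw [one_div, inv_div]
    rfl
  have hprod := tsum_mul_tsum_eq_tsum_sum_antidiagonal_of_summable_norm hs1.summable.norm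
    hs2.summable.norm
  have hsum := summable_norm_sum_mul_antidiagonal_of_summable_norm hs1.summable.norm
    hs2.summable.norm
  rw [hs1.tsum_eq, hs2.tsum_eq, hval] at hprod
  rw [← Complex.hasSum_ofReal, hprod]
  simp only [hG]
  exact hsum.of_norm.hasSum

end Generating

/-- A smooth function equal to `1` on `(-∞, 1]` and to `0` on `[2, ∞)`. -/
def cut (t : ℝ) : ℝ := 1 - Real.smoothTransition (t - 1)

lemma contDiff_cut {m : ℕ∞} : ContDiff ℝ m cut :=
  contDiff_const.sub (Real.smoothTransition.contDiff.comp (contDiff_id.sub contDiff_const))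

lemma cut_eq_one {t : ℝ} (h : t ≤ 1) : cut t = 1 := by
  rw [cut, Real.smoothTransition.zero_of_nonpos (by linarith), sub_zero]

lemma cut_eq_zero {t : ℝ} (h : 2 ≤ t) : cut t = 0 := by
  rw [cut, Real.smoothTransition.one_of_one_le (by linarith), sub_self]

lemma abs_cut_le (t : ℝ) : |cut t| ≤ 1 := by
  have := Real.smoothTransition.nonneg (t - 1)
  have := Real.smoothTransition.le_one (t - 1)
  rw [cut, abs_le]
  constructor <;> linarith

lemma contDiff_deriv_cut {m : ℕ} : ContDiff ℝ m (deriv cut) :=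
  (contDiff_cut (m := (m + 1 : ℕ))).iterate_deriv' m 1

lemma hasDerivAt_cut (t : ℝ) : HasDerivAt cut (deriv cut t) t :=
  ((contDiff_cut (m := 1)).differentiable (by norm_num) t).hasDerivAt

lemma hasDerivAt_deriv_cut (t : ℝ) : HasDerivAt (deriv cut) (deriv (deriv cut) t) t :=
  ((contDiff_deriv_cut (m := 1)).differentiable (by norm_num) t).hasDerivAt

lemma deriv_cut_eventuallyEq {t : ℝ} (h : t < 1 ∨ 2 < t) : deriv cut =ᶠ[nhds t] fun _ => 0 := by
  rcases h with h | h
  · have : cut =ᶠ[nhds t] fun _ => 1 := (eventually_lt_nhds h).mono fun s hs => cut_eq_one hs.le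
    simpa using this.deriv
  · have : cut =ᶠ[nhds t] fun _ => 0 := (eventually_gt_nhds h).mono fun s hs => cut_eq_zero hs.le
    simpa using this.deriv

lemma deriv_cut_eq_zero {t : ℝ} (h : t < 1 ∨ 2 < t) : deriv cut t = 0 :=
  (deriv_cut_eventuallyEq h).eq_of_nhds

lemma deriv_deriv_cut_eq_zero {t : ℝ} (h : t < 1 ∨ 2 < t) : deriv (deriv cut) t = 0 := by
  simpa using (deriv_cut_eventuallyEq h).deriv.eq_of_nhds

section Representation

variable {n : ℕ}

lemma hasDerivAt_add_sq_rpow {ε : ℝ} (hε : 0 < ε) (p : ℝ) {t : ℝ} (ht : 0 ≤ t) :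
    HasDerivAt (fun t => (t + ε ^ 2) ^ p) (p * (t + ε ^ 2) ^ (p - 1)) t := by
  have := ((hasDerivAt_id t).add_const (ε ^ 2)).rpow_const (p := p) (Or.inl (by simp; positivity))
  simpa [mul_comm] using this

/-- The regularised fundamental solution of the Laplacian with pole `x`. -/
def kerReg (n : ℕ) (ε : ℝ) (x y : E n) : ℝ := (‖y - x‖ ^ 2 + ε ^ 2) ^ (-lam n)

lemma contDiff_kerReg {ε : ℝ} (hε : 0 < ε) (x : E n) : ContDiff ℝ 2 (kerReg n ε x) := by
  unfold kerReg
  refine ContDiff.rpow_const_of_ne ?_ fun y => by positivity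
  exact ((contDiff_id.sub contDiff_const).norm_sq ℝ).add contDiff_const

lemma lap_kerReg {ε : ℝ} (hε : 0 < ε) (x y : E n) :
    lap n (kerReg n ε x) y
      = -(2 * lam n * n * ε ^ 2) * (‖y - x‖ ^ 2 + ε ^ 2) ^ (-lam n - 2) := by
  have := lap_radial (φ := fun t => (t + ε ^ 2) ^ (-lam n))
    (φ' := fun t => -lam n * (t + ε ^ 2) ^ (-lam n - 1))
    (φ'' := fun t => -lam n * ((-lam n - 1) * (t + ε ^ 2) ^ (-lam n - 1 - 1)))
    (fun t ht => hasDerivAt_add_sq_rpow hε _ ht)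
    (fun t ht => (hasDerivAt_add_sq_rpow hε _ ht).const_mul _) x y
  unfold kerReg
  rw [this]
  have h : 0 < ‖y - x‖ ^ 2 + ε ^ 2 := by positivity
  have e : (‖y - x‖ ^ 2 + ε ^ 2) ^ (-lam n - 1)
      = (‖y - x‖ ^ 2 + ε ^ 2) ^ (-lam n - 2) * (‖y - x‖ ^ 2 + ε ^ 2) := by
    rw [← Real.rpow_add_one h.ne']
    congr 1
    ring
  have e2 : -lam n - 1 - 1 = -lam n - 2 := by ring
  have hl : lam n = (n - 2) / 2 := rfl
  simp only [e, e2]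
  rw [hl]
  ring

/-- The error produced by cutting off the regularised fundamental solution, at unit scale. -/
def shell (n : ℕ) (q : E n × ℝ) (z : E n) : ℝ :=
  8 * deriv cut (‖z‖ ^ 2) * inner ℝ z (z - q.1)
      * (-lam n * (max (‖z - q.1‖ ^ 2) (1 / 4) + q.2 ^ 2) ^ (-lam n - 1))
    + (max (‖z - q.1‖ ^ 2) (1 / 4) + q.2 ^ 2) ^ (-lam n)
      * (2 * n * deriv cut (‖z‖ ^ 2) + 4 * ‖z‖ ^ 2 * deriv (deriv cut) (‖z‖ ^ 2))

lemma Continuous.shell {X : Type*} [TopologicalSpace X] {q : X → E n × ℝ} {z : X → E n}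
    (hq : Continuous q) (hz : Continuous z) : Continuous fun v => shell n (q v) (z v) := by
  have h1 : Continuous (deriv cut) := (contDiff_deriv_cut (m := 1)).continuous
  have h2 : Continuous (deriv (deriv cut)) :=
    (contDiff_deriv_cut (m := 1)).continuous_deriv (by norm_num)
  have hB : Continuous fun v => max (‖z v - (q v).1‖ ^ 2) (1 / 4) + (q v).2 ^ 2 := by fun_prop
  have hB' (v : X) : max (‖z v - (q v).1‖ ^ 2) (1 / 4) + (q v).2 ^ 2 ≠ 0 := by
    positivity
  have hp (p : ℝ) := hB.rpow_const (p := p) fun v => Or.inl (hB' v)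
  have hp1 := hp (-lam n - 1)
  have hp2 := hp (-lam n)
  unfold _root_.shell
  fun_prop

lemma shell_eq_zero (q : E n × ℝ) {z : E n} (h : ‖z‖ ^ 2 < 1 ∨ 2 < ‖z‖ ^ 2) : shell n q z = 0 := by
  simp [shell, deriv_cut_eq_zero h, deriv_deriv_cut_eq_zero h]

lemma hasCompactSupport_shell (q : E n × ℝ) : HasCompactSupport (shell n q) := by
  refine HasCompactSupport.intro (isCompact_closedBall 0 2) fun z hz => shell_eq_zero q (Or.inr ?_)
  have : 2 < ‖z‖ := by simpa using hz
  nlinarith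

lemma contDiff_cut_norm (ρ : ℝ) : ContDiff ℝ 2 fun y : E n => cut (‖y‖ ^ 2 / ρ ^ 2) :=
  (contDiff_cut (m := 2)).comp ((contDiff_id.norm_sq ℝ).div_const _)

lemma hasCompactSupport_cut_norm {ρ : ℝ} (hρ : 0 < ρ) :
    HasCompactSupport fun y : E n => cut (‖y‖ ^ 2 / ρ ^ 2) := by
  refine HasCompactSupport.intro (isCompact_closedBall 0 (2 * ρ)) fun z hz => cut_eq_zero ?_
  have : 2 * ρ < ‖z‖ := by simpa using hz
  rw [le_div_iff₀ (by positivity)]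
  nlinarith

lemma lap_cut_mul_kerReg {ε ρ : ℝ} (hε : 0 < ε) (hρ : 0 < ρ) {x : E n} (hx : 2 * ‖x‖ ≤ ρ) (y : E n) :
    lap n (fun y => cut (‖y‖ ^ 2 / ρ ^ 2) * kerReg n ε x y) y
      = cut (‖y‖ ^ 2 / ρ ^ 2) * lap n (kerReg n ε x) y
        + (ρ ^ n)⁻¹ * shell n (ρ⁻¹ • x, ρ⁻¹ * ε) (ρ⁻¹ • y) := by
  have d1 (t : ℝ) : HasDerivAt (fun t => cut (t / ρ ^ 2)) (deriv cut (t / ρ ^ 2) * (1 / ρ ^ 2)) t :=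
    HasDerivAt.comp (h₂ := cut) t (hasDerivAt_cut (t / ρ ^ 2)) ((hasDerivAt_id t).div_const (ρ ^ 2))
  have d2 (t : ℝ) : HasDerivAt (fun t => deriv cut (t / ρ ^ 2) * (1 / ρ ^ 2))
      (deriv (deriv cut) (t / ρ ^ 2) * (1 / ρ ^ 2) * (1 / ρ ^ 2)) t :=
    (HasDerivAt.comp (h₂ := deriv cut) t (hasDerivAt_deriv_cut (t / ρ ^ 2))
      ((hasDerivAt_id t).div_const (ρ ^ 2))).mul_const _
  have hl := lap_radial (fun t _ => d1 t) (fun t _ => d2 t) (0 : E n) y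
  have hp (i : Fin n) := pd_radial (i := i) (x := y) (fun t _ => d1 t) (0 : E n)
  have hq (i : Fin n) : pd i (kerReg n ε x) y = _ := pd_radial (i := i) (x := y)
    (fun t ht => hasDerivAt_add_sq_rpow hε (-lam n) ht) x
  simp only [sub_zero, PiLp.zero_apply] at hl hp
  rw [lap_mul (contDiff_cut_norm ρ) (contDiff_kerReg hε x), hl, add_assoc]
  congr 1
  have hsum : ∑ i, pd i (fun y : E n => cut (‖y‖ ^ 2 / ρ ^ 2)) y * pd i (kerReg n ε x) y
      = (deriv cut (‖y‖ ^ 2 / ρ ^ 2) * (1 / ρ ^ 2))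
        * (-lam n * (‖y - x‖ ^ 2 + ε ^ 2) ^ (-lam n - 1)) * (4 * inner ℝ y (y - x)) := by
    rw [PiLp.inner_apply, Finset.mul_sum, Finset.mul_sum]
    refine Finset.sum_congr rfl fun i _ => ?_
    rw [hp, hq]
    simp
    ring
  rw [hsum]
  have hz : ‖ρ⁻¹ • y‖ ^ 2 = ‖y‖ ^ 2 / ρ ^ 2 := by
    rw [norm_smul, norm_inv, norm_of_nonneg hρ.le]
    field_simp
  rcases lt_or_ge (‖y‖ ^ 2 / ρ ^ 2) 1 with h | h
  · rw [shell_eq_zero _ (Or.inl (by rwa [hz])), deriv_cut_eq_zero (Or.inl h),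
      deriv_deriv_cut_eq_zero (Or.inl h)]
    simp
  · have hy : ρ ≤ ‖y‖ := by
      rw [le_div_iff₀ (by positivity), one_mul] at h
      exact (pow_le_pow_iff_left₀ hρ.le (norm_nonneg _) two_ne_zero).1 h
    have hyx : ρ / 2 ≤ ‖y - x‖ := by
      have := norm_sub_norm_le y x
      linarith
    have hzx : ‖ρ⁻¹ • y - ρ⁻¹ • x‖ ^ 2 = ‖y - x‖ ^ 2 / ρ ^ 2 := by
      rw [← smul_sub, norm_smul, norm_inv, norm_of_nonneg hρ.le]
      field_simp
    have hmax : max (‖ρ⁻¹ • y - ρ⁻¹ • x‖ ^ 2) (1 / 4) + (ρ⁻¹ * ε) ^ 2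
        = (‖y - x‖ ^ 2 + ε ^ 2) / ρ ^ 2 := by
      rw [max_eq_left, hzx]
      · field_simp
      · rw [hzx, le_div_iff₀ (by positivity)]
        nlinarith
    have hA : 0 < ‖y - x‖ ^ 2 + ε ^ 2 := by positivity
    have hpn : (ρ ^ 2) ^ (-lam n - 1) = (ρ ^ n)⁻¹ := by
      rw [← Real.rpow_natCast, ← Real.rpow_natCast, ← Real.rpow_mul hρ.le, ← Real.rpow_neg hρ.le]
      congr 1
      simp [lam]
      ring
    have hpn' : (ρ ^ 2) ^ (-lam n) = (ρ ^ n)⁻¹ * ρ ^ 2 := by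
      rw [← hpn, ← Real.rpow_add_one (by positivity)]
      congr 1
      ring
    have hin : inner ℝ (ρ⁻¹ • y) (ρ⁻¹ • y - ρ⁻¹ • x) = inner ℝ y (y - x) / ρ ^ 2 := by
      rw [← smul_sub, real_inner_smul_left, real_inner_smul_right]
      field_simp
    simp only [shell, hmax, hz, hin]
    rw [Real.div_rpow hA.le (by positivity), Real.div_rpow hA.le (by positivity), hpn, hpn']
    simp only [kerReg]
    field_simp
    ring

end Representation

section Representation

variable {n : ℕ}

open MeasureTheory Filter Topology

lemma integrable_one_add_norm_sq : Integrable fun z : E n => (1 + ‖z‖ ^ 2) ^ (-lam n - 2) := by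
  have := integrable_rpow_neg_one_add_norm_sq (E := E n) (μ := volume) (r := n + 2)
    (by simp)
  refine this.congr (ae_of_all _ fun z => ?_)
  simp only [lam]
  congr 1
  ring

lemma rpow_norm_sq_add_sq {ε : ℝ} (hε : 0 < ε) (z : E n) (p : ℝ) :
    (‖z‖ ^ 2 + ε ^ 2) ^ p = (ε ^ 2) ^ p * (1 + ‖ε⁻¹ • z‖ ^ 2) ^ p := by
  rw [← Real.mul_rpow (by positivity) (by positivity), norm_smul, norm_inv, norm_of_nonneg hε.le]
  congr 1
  field_simp
  ring

lemma integrable_lap_kerReg {ε : ℝ} (hε : 0 < ε) (x : E n) :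
    Integrable (lap n (kerReg n ε x)) := by
  have h : lap n (kerReg n ε x)
      = fun y => -(2 * lam n * n * ε ^ 2) * (‖y - x‖ ^ 2 + ε ^ 2) ^ (-lam n - 2) :=
    funext fun y => lap_kerReg hε x y
  rw [h]
  refine Integrable.const_mul ?_ _
  have h1 : Integrable fun z : E n => (‖z‖ ^ 2 + ε ^ 2) ^ (-lam n - 2) := by
    simp only [rpow_norm_sq_add_sq hε]
    exact (integrable_one_add_norm_sq.comp_smul (inv_ne_zero hε.ne')).const_mul _
  exact h1.comp_sub_right x

lemma integral_kerReg_mul_lap {w : E n → ℝ} (hw : ContDiff ℝ 2 w) {b : ℝ}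
    (hb : ∀ y, b < ‖y‖ → lap n w y = 0) {ε ρ : ℝ} (hε : 0 < ε) (hρ : 0 < ρ) {x : E n}
    (hx : 2 * ‖x‖ ≤ ρ) (hbρ : b ≤ ρ) :
    ∫ y, kerReg n ε x y * lap n w y
      = (∫ y, cut (‖y‖ ^ 2 / ρ ^ 2) * (w y * lap n (kerReg n ε x) y))
        + ∫ z, w (ρ • z) * shell n (ρ⁻¹ • x, ρ⁻¹ * ε) z := by
  have hK := contDiff_kerReg hε x
  have hψ := contDiff_cut_norm (n := n) ρ
  have hcs := hasCompactSupport_cut_norm (n := n) hρ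
  have h := integral_mul_lap (hψ.mul hK) hw (Or.inl hcs.mul_right)
  have h1 : ∫ y, kerReg n ε x y * lap n w y
      = ∫ y, (cut (‖y‖ ^ 2 / ρ ^ 2) * kerReg n ε x y) * lap n w y := by
    refine integral_congr_ae (ae_of_all _ fun y => ?_)
    by_cases hy : b < ‖y‖
    · simp [hb y hy]
    · have : cut (‖y‖ ^ 2 / ρ ^ 2) = 1 := by
        refine cut_eq_one ?_
        rw [div_le_one (by positivity)]
        have : ‖y‖ ≤ ρ := by linarith
        gcongr
      simp [this]
  have h2 : ∫ z, w (ρ • z) * shell n (ρ⁻¹ • x, ρ⁻¹ * ε) z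
      = ∫ y, w y * ((ρ ^ n)⁻¹ * shell n (ρ⁻¹ • x, ρ⁻¹ * ε) (ρ⁻¹ • y)) := by
    have := Measure.integral_comp_smul_of_nonneg (volume : Measure (E n))
      (fun y => w y * shell n (ρ⁻¹ • x, ρ⁻¹ * ε) (ρ⁻¹ • y)) ρ (hR := hρ.le)
    simp only [inv_smul_smul₀ hρ.ne', finrank_euclideanSpace_fin, smul_eq_mul] at this
    rw [this, ← integral_const_mul]
    congr 1
    ext y
    ring
  rw [h1, h, h2, ← integral_add]
  · congr 1
    ext y
    rw [lap_cut_mul_kerReg hε hρ hx]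
    ring
  · refine (Continuous.integrable_of_hasCompactSupport ?_ hcs.mul_right)
    exact hψ.continuous.mul (hw.continuous.mul (continuous_lap hK))
  · refine (Continuous.integrable_of_hasCompactSupport ?_ ?_)
    · have : Continuous fun y : E n => shell n (ρ⁻¹ • x, ρ⁻¹ * ε) (ρ⁻¹ • y) :=
        continuous_const.shell (continuous_const_smul ρ⁻¹)
      exact hw.continuous.mul (continuous_const.mul this)
    · refine HasCompactSupport.mul_left (HasCompactSupport.mul_left ?_)
      exact (hasCompactSupport_shell _).comp_smul (inv_ne_zero hρ.ne')

lemma tendsto_integral_cut_mul {g : E n → ℝ} (hg : Integrable g) :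
    Tendsto (fun ρ : ℝ => ∫ y, cut (‖y‖ ^ 2 / ρ ^ 2) * g y) atTop (𝓝 (∫ y, g y)) := by
  refine tendsto_integral_filter_of_dominated_convergence (fun y => ‖g y‖) ?_ ?_ hg.norm ?_
  · exact Eventually.of_forall fun ρ =>
      (contDiff_cut_norm ρ).continuous.aestronglyMeasurable.mul hg.aestronglyMeasurable
  · refine Eventually.of_forall fun ρ => ae_of_all _ fun y => ?_
    rw [norm_mul]
    exact mul_le_of_le_one_left (norm_nonneg _) (abs_cut_le _)
  · refine ae_of_all _ fun y => tendsto_const_nhds.congr' ?_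
    filter_upwards [eventually_ge_atTop (‖y‖ + 1)] with ρ hρ
    have h0 := norm_nonneg y
    rw [cut_eq_one, one_mul]
    have h1 : 0 < ρ := by linarith
    rw [div_le_one (by positivity)]
    gcongr
    linarith

lemma tendsto_integral_shell {w : E n → ℝ} (hw : Continuous w) {M : ℝ} (hM : ∀ y, |w y| ≤ M)
    (x : E n) (ε : ℝ) :
    Tendsto (fun ρ : ℝ => (∫ z, w (ρ • z) * shell n (ρ⁻¹ • x, ρ⁻¹ * ε) z)
      - ∫ z, w (ρ • z) * shell n 0 z) atTop (𝓝 0) := by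
  let N (q : E n × ℝ) : ℝ := ∫ z in Metric.closedBall (0 : E n) 2, |shell n q z - shell n 0 z|
  have hN : Continuous N := by
    refine continuous_parametric_integral_of_continuous (f := fun q z => |shell n q z - shell n 0 z|)
      ?_ (isCompact_closedBall _ _)
    have h1 : Continuous fun v : (E n × ℝ) × E n => shell n v.1 v.2 :=
      continuous_fst.shell continuous_snd
    have h2 : Continuous fun v : (E n × ℝ) × E n => shell n 0 v.2 :=
      continuous_const.shell continuous_snd
    exact (h1.sub h2).abs
  have hN0 : N 0 = 0 := by simp [N]
  have hq : Tendsto (fun ρ : ℝ => (ρ⁻¹ • x, ρ⁻¹ * ε)) atTop (𝓝 (0 : E n × ℝ)) := by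
    have h1 := (tendsto_inv_atTop_zero (𝕜 := ℝ)).smul_const x
    have h2 := (tendsto_inv_atTop_zero (𝕜 := ℝ)).mul_const ε
    rw [zero_smul] at h1
    rw [zero_mul] at h2
    exact h1.prodMk_nhds h2
  have hlim := ((hN.tendsto 0).comp hq).const_mul M
  rw [hN0, mul_zero] at hlim
  refine squeeze_zero_norm (fun ρ => ?_) hlim
  set q : E n × ℝ := (ρ⁻¹ • x, ρ⁻¹ * ε)
  have hs (q : E n × ℝ) : Continuous (shell n q) :=
    continuous_const.shell continuous_id
  have hi (q : E n × ℝ) : Integrable fun z => w (ρ • z) * shell n q z :=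
    Continuous.integrable_of_hasCompactSupport
      ((hw.comp (continuous_const_smul ρ)).mul (hs q)) (hasCompactSupport_shell q).mul_left
  have hd : Integrable fun z => |shell n q z - shell n 0 z| :=
    (((hs q).integrable_of_hasCompactSupport (hasCompactSupport_shell q)).sub
      ((hs 0).integrable_of_hasCompactSupport (hasCompactSupport_shell 0))).abs
  rw [← integral_sub (hi q) (hi 0)]
  calc _ ≤ ∫ z, M * |shell n q z - shell n 0 z| := by
        refine norm_integral_le_of_norm_le (hd.const_mul M) (ae_of_all _ fun z => ?_)
        rw [← mul_sub, norm_mul]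
        exact mul_le_mul_of_nonneg_right (hM _) (norm_nonneg _)
    _ = M * N q := by
        rw [integral_const_mul]
        congr 1
        refine (setIntegral_eq_integral_of_forall_compl_eq_zero fun z hz => ?_).symm
        have h2 : 2 < ‖z‖ := by simpa using hz
        rw [shell_eq_zero q (Or.inr (by nlinarith)), shell_eq_zero 0 (Or.inr (by nlinarith))]
        simp

/-- Green's representation of a bounded function with compactly supported Laplacian, up to an
additive constant independent of the pole and of the regularisation. -/
lemma exists_integral_kerReg_eq {w : E n → ℝ} (hw : ContDiff ℝ 2 w) {M b : ℝ}
    (hM : ∀ y, |w y| ≤ M) (hb : ∀ y, b < ‖y‖ → lap n w y = 0) :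
    ∃ D : ℝ, ∀ ε, 0 < ε → ∀ x, ∫ y, kerReg n ε x y * lap n w y
      = (∫ y, w y * lap n (kerReg n ε x) y) + D := by
  have key (ε : ℝ) (hε : 0 < ε) (x : E n) :
      Tendsto (fun ρ : ℝ => ∫ z, w (ρ • z) * shell n 0 z) atTop
        (𝓝 ((∫ y, kerReg n ε x y * lap n w y) - ∫ y, w y * lap n (kerReg n ε x) y)) := by
    have hi : Integrable fun y => w y * lap n (kerReg n ε x) y :=
      (integrable_lap_kerReg hε x).bdd_mul hw.continuous.aestronglyMeasurable
        (ae_of_all _ hM)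
    have h1 := (tendsto_const_nhds (x := ∫ y, kerReg n ε x y * lap n w y)).sub
      (tendsto_integral_cut_mul hi)
    have h2 := h1.sub (tendsto_integral_shell hw.continuous hM x ε)
    rw [sub_zero] at h2
    refine h2.congr' ?_
    filter_upwards [eventually_gt_atTop 0, eventually_ge_atTop (2 * ‖x‖), eventually_ge_atTop b]
      with ρ h0 hx hbρ
    rw [integral_kerReg_mul_lap hw hb hε h0 hx hbρ]
    ring
  refine ⟨(∫ y, kerReg n 1 0 y * lap n w y) - ∫ y, w y * lap n (kerReg n 1 0) y,
    fun ε hε x => ?_⟩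
  rw [← tendsto_nhds_unique (key ε hε x) (key 1 one_pos 0)]
  ring

/-- The normalising constant of the fundamental solution. -/
def fundConst (n : ℕ) : ℝ := ∫ z : E n, -(2 * lam n * n) * (1 + ‖z‖ ^ 2) ^ (-lam n - 2)

lemma fundConst_ne_zero (hn : 3 ≤ n) : fundConst n ≠ 0 := by
  rw [fundConst, integral_const_mul]
  refine mul_ne_zero ?_ ?_
  · have := lam_pos hn
    have : 0 < n := by omega
    exact neg_ne_zero.2 (by positivity)
  · refine ne_of_gt (integral_pos_of_integrable_nonneg_nonzero (x := 0) ?_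
      integrable_one_add_norm_sq (fun z => by positivity) (by simp))
    have : ∀ z : E n, 1 + ‖z‖ ^ 2 ≠ 0 := fun z => by positivity
    exact Continuous.rpow_const (by fun_prop) fun z => Or.inl (this z)

lemma tendsto_integral_mul_lap_kerReg {w : E n → ℝ} (hw : Continuous w) {M : ℝ}
    (hM : ∀ y, |w y| ≤ M) (x : E n) :
    Tendsto (fun ε : ℝ => ∫ y, w y * lap n (kerReg n ε x) y) (𝓝[>] 0)
      (𝓝 (fundConst n * w x)) := by
  let F (ε : ℝ) (z : E n) : ℝ :=
    w (x + ε • z) * (-(2 * lam n * n) * (1 + ‖z‖ ^ 2) ^ (-lam n - 2))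
  have hF : ∀ ε > 0, ∫ z, F ε z = ∫ y, w y * lap n (kerReg n ε x) y := by
    intro ε hε
    have h1 := integral_add_left_eq_self (μ := (volume : Measure (E n)))
      (fun y => w y * lap n (kerReg n ε x) y) x
    have h2 := Measure.integral_comp_smul_of_nonneg (volume : Measure (E n))
      (fun z => w (x + z) * lap n (kerReg n ε x) (x + z)) ε (hR := hε.le)
    rw [h1, smul_eq_mul, finrank_euclideanSpace_fin] at h2
    have hp : (ε ^ 2) ^ (-lam n - 2) * ε ^ 2 = (ε ^ n)⁻¹ := by
      rw [← Real.rpow_add_one (by positivity), ← Real.rpow_natCast, ← Real.rpow_natCast,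
        ← Real.rpow_mul hε.le, ← Real.rpow_neg hε.le]
      congr 1
      simp [lam]
      ring
    have h3 : ∫ z, w (x + ε • z) * lap n (kerReg n ε x) (x + ε • z)
        = (ε ^ n)⁻¹ * ∫ z, F ε z := by
      rw [← integral_const_mul]
      congr 1
      ext z
      rw [lap_kerReg hε, add_sub_cancel_left, rpow_norm_sq_add_sq hε, inv_smul_smul₀ hε.ne', ← hp]
      simp only [F]
      ring
    rw [h3] at h2
    exact mul_left_cancel₀ (by positivity) h2
  refine Tendsto.congr' (eventually_mem_nhdsWithin.mono hF) ?_
  have hlim : fundConst n * w x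
      = ∫ z : E n, w x * (-(2 * lam n * n) * (1 + ‖z‖ ^ 2) ^ (-lam n - 2)) := by
    rw [integral_const_mul, fundConst, mul_comm]
  rw [hlim]
  have hint := (integrable_one_add_norm_sq (n := n)).const_mul (-(2 * lam n * n))
  refine tendsto_integral_filter_of_dominated_convergence
    (fun z : E n => M * ‖-(2 * lam n * n) * (1 + ‖z‖ ^ 2) ^ (-lam n - 2)‖) ?_ ?_ (hint.norm.const_mul M) ?_
  · refine Eventually.of_forall fun ε => ?_
    exact (Continuous.aestronglyMeasurable (by fun_prop)).mul hint.aestronglyMeasurable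
  · refine Eventually.of_forall fun ε => ae_of_all _ fun z => ?_
    rw [norm_mul]
    exact mul_le_mul_of_nonneg_right (hM _) (norm_nonneg _)
  · refine ae_of_all _ fun z => Tendsto.mul_const _ ?_
    have : Continuous fun ε : ℝ => w (x + ε • z) := by fun_prop
    have := this.tendsto 0
    simp only [zero_smul, add_zero] at this
    exact this.mono_left nhdsWithin_le_nhds

lemma tendsto_integral_kerReg_mul (hn : 3 ≤ n) {f : E n → ℝ} (hf : Integrable f) {b : ℝ}
    (hb : ∀ y, b < ‖y‖ → f y = 0) {x : E n} (hx : b < ‖x‖) :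
    Tendsto (fun ε : ℝ => ∫ y, kerReg n ε x y * f y) (𝓝[>] 0)
      (𝓝 (∫ y, (‖x - y‖ ^ 2) ^ (-lam n) * f y)) := by
  have hl := lam_pos hn
  have hd : 0 < ‖x‖ - b := by linarith
  have hdist (y : E n) (hy : ‖y‖ ≤ b) : (‖x‖ - b) ^ 2 ≤ ‖y - x‖ ^ 2 := by
    have := norm_sub_norm_le x y
    rw [norm_sub_rev] at this
    have : ‖x‖ - b ≤ ‖y - x‖ := by linarith
    gcongr
  refine tendsto_integral_filter_of_dominated_convergence
    (fun y => ((‖x‖ - b) ^ 2) ^ (-lam n) * ‖f y‖) ?_ ?_ (hf.norm.const_mul _) ?_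
  · refine Eventually.of_forall fun ε => AEStronglyMeasurable.mul ?_ hf.aestronglyMeasurable
    unfold kerReg
    exact Measurable.aestronglyMeasurable (by fun_prop)
  · refine Eventually.of_forall fun ε => ae_of_all _ fun y => ?_
    by_cases hy : b < ‖y‖
    · simp [hb y hy]
    · rw [norm_mul, kerReg, norm_of_nonneg (by positivity)]
      refine mul_le_mul_of_nonneg_right ?_ (norm_nonneg _)
      refine Real.rpow_le_rpow_of_nonpos (by positivity) ?_ (by linarith)
      have := hdist y (not_lt.1 hy)
      nlinarith [sq_nonneg ε]
  · refine ae_of_all _ fun y => ?_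
    by_cases hy : b < ‖y‖
    · simp [hb y hy]
    · refine Tendsto.mul_const _ ?_
      have hpos : 0 < ‖y - x‖ ^ 2 := (by positivity : 0 < (‖x‖ - b) ^ 2).trans_le
        (hdist y (not_lt.1 hy))
      have hc : Continuous fun ε : ℝ => (‖y - x‖ ^ 2 + ε ^ 2) ^ (-lam n) :=
        Continuous.rpow_const (by fun_prop) fun ε => Or.inl (by positivity)
      have := hc.tendsto 0
      rw [norm_sub_rev x y]
      simp only [ne_eq, OfNat.ofNat_ne_zero, not_false_eq_true, zero_pow, add_zero] at this
      exact this.mono_left nhdsWithin_le_nhds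

lemma exists_fundConst_mul_eq (hn : 3 ≤ n) {w : E n → ℝ} (hw : ContDiff ℝ 2 w) {M b : ℝ}
    (hM : ∀ y, |w y| ≤ M) (hb : ∀ y, b < ‖y‖ → lap n w y = 0) :
    ∃ D : ℝ, ∀ x, b < ‖x‖ →
      fundConst n * w x = (∫ y, (‖x - y‖ ^ 2) ^ (-lam n) * lap n w y) + D := by
  have hf : Integrable (lap n w) :=
    (continuous_lap hw).integrable_of_hasCompactSupport
      (HasCompactSupport.intro (isCompact_closedBall 0 b) fun y hy => hb y (by simpa using hy))
  obtain ⟨D, hD⟩ := exists_integral_kerReg_eq hw hM hb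
  refine ⟨-D, fun x hx => ?_⟩
  have h1 := (tendsto_integral_mul_lap_kerReg hw.continuous hM x).add_const D
  have h2 := tendsto_integral_kerReg_mul hn hf hb hx
  have h3 := h2.congr' (eventually_mem_nhdsWithin.mono fun ε hε => hD ε hε x)
  rw [← tendsto_nhds_unique h1 h3]
  ring

end Representation

section Expansion

variable {n : ℕ}

open MeasureTheory Filter Topology

/-- The degree `k` term of the expansion at infinity of a function harmonic near infinity. -/
def multipole (n k : ℕ) (w : E n → ℝ) (x : E n) : ℝ :=
  (fundConst n)⁻¹ * ∫ y, zonal n k x y * lap n w y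

lemma integrable_mul_lap {g w : E n → ℝ} (hg : Continuous g) (hw : ContDiff ℝ 2 w) {b : ℝ}
    (hb : ∀ y, b < ‖y‖ → lap n w y = 0) : Integrable fun y => g y * lap n w y :=
  (hg.mul (continuous_lap hw)).integrable_of_hasCompactSupport <|
    HasCompactSupport.intro (isCompact_closedBall 0 b) fun y hy => by
      simp [hb y (by simpa using hy)]

lemma isHHP_multipole {w : E n → ℝ} (hw : ContDiff ℝ 2 w) {b : ℝ}
    (hb : ∀ y, b < ‖y‖ → lap n w y = 0) (k : ℕ) : IsHHP n k (multipole n k w) := by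
  obtain ⟨Q, hQ⟩ := exists_zonal_eq_eval n k
  let X (m : Fin n →₀ ℕ) (x : E n) : ℝ := ∏ i ∈ m.support, x i ^ m i
  let a (m : Fin n →₀ ℕ) (y : E n) : ℝ := MvPolynomial.eval (fun i => y i) (Q.coeff m)
  have ha (m : Fin n →₀ ℕ) : Continuous (a m) :=
    (MvPolynomial.continuous_eval (Q.coeff m)).comp (by fun_prop)
  have hX (m : Fin n →₀ ℕ) : ContDiff ℝ 2 (X m) := by
    refine contDiff_prod fun i _ => ContDiff.pow ?_ _
    exact (EuclideanSpace.proj i : E n →L[ℝ] ℝ).contDiff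
  have hz (x y : E n) : zonal n k x y = ∑ m ∈ Q.support, a m y * X m x := by
    rw [hQ, MvPolynomial.eval_map, MvPolynomial.eval₂_eq]
  have hp (V : (Fin n →₀ ℕ) → ℝ) :
      ∑ m ∈ Q.support, ((fundConst n)⁻¹ * ∫ y, a m y * lap n w y) * V m
        = (fundConst n)⁻¹ * ∫ y, (∑ m ∈ Q.support, a m y * V m) * lap n w y := by
    simp only [Finset.sum_mul]
    rw [integral_finsetSum, Finset.mul_sum]
    · refine Finset.sum_congr rfl fun m _ => ?_
      rw [mul_assoc, ← integral_mul_const]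
      congr 2
      ext y
      ring
    · exact fun m _ => integrable_mul_lap ((ha m).mul continuous_const) hw hb
  have hm (x : E n) : multipole n k w x
      = ∑ m ∈ Q.support, ((fundConst n)⁻¹ * ∫ y, a m y * lap n w y) * X m x := by
    rw [hp, multipole]
    simp only [hz]
  refine ⟨⟨∑ m ∈ Q.support,
    MvPolynomial.monomial m ((fundConst n)⁻¹ * ∫ y, a m y * lap n w y), fun x => ?_⟩,
    fun c x => ?_, fun x => ?_⟩
  · rw [hm, map_sum]
    refine Finset.sum_congr rfl fun m _ => ?_
    rw [MvPolynomial.eval_monomial]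
    rfl
  · simp only [multipole, zonal_smul, mul_assoc, integral_const_mul]
    ring
  · rw [funext hm, lap_sum _ _ fun m => contDiff_const.mul (hX m)]
    simp only [lap_const_mul (hX _)]
    rw [hp]
    have h0 (y : E n) : ∑ m ∈ Q.support, a m y * lap n (X m) x = 0 := by
      rw [← lap_zonal k x y, funext fun x => hz x y,
        lap_sum _ _ fun m => contDiff_const.mul (hX m)]
      simp only [lap_const_mul (hX _)]
    simp [h0]

lemma multipole_congr {w₁ w₂ : E n → ℝ} (h₁ : ContDiff ℝ 2 w₁) (h₂ : ContDiff ℝ 2 w₂) {b₁ b₂ R : ℝ}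
    (hb₁ : ∀ y, b₁ < ‖y‖ → lap n w₁ y = 0) (hb₂ : ∀ y, b₂ < ‖y‖ → lap n w₂ y = 0)
    (hR : ∀ y, R < ‖y‖ → w₁ y = w₂ y) (k : ℕ) (x : E n) :
    multipole n k w₁ x = multipole n k w₂ x := by
  have hz : ContDiff ℝ 2 (zonal n k x) := contDiff_zonal_right k x
  have hc : HasCompactSupport fun y => w₁ y - w₂ y :=
    HasCompactSupport.intro (isCompact_closedBall 0 R) fun y hy =>
      sub_eq_zero.2 (hR y (by simpa using hy))
  have h := integral_mul_lap hz (h₁.sub h₂) (Or.inr hc)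
  have hl (y : E n) : lap n (zonal n k x) y = 0 := by
    rw [← lap_zonal k y x]
    congr 1
    exact funext fun z => zonal_symm k x z
  simp only [lap_sub h₁ h₂, hl, mul_sub, mul_zero, integral_zero] at h
  rw [integral_sub (integrable_mul_lap hz.continuous h₁ hb₁)
    (integrable_mul_lap hz.continuous h₂ hb₂), sub_eq_zero] at h
  rw [multipole, multipole, h]

lemma exists_hasSum_multipole (hn : 3 ≤ n) {w : E n → ℝ} (hw : ContDiff ℝ 2 w) {M b : ℝ}
    (h0 : 0 ≤ b) (hM : ∀ y, |w y| ≤ M) (hb : ∀ y, b < ‖y‖ → lap n w y = 0) :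
    ∃ c : ℝ, ∀ x, b < ‖x‖ →
      HasSum (fun k : ℕ => ‖x‖ ^ ((2 : ℝ) - n - 2 * k) * multipole n k w x) (w x - c) := by
  obtain ⟨D, hD⟩ := exists_fundConst_mul_eq hn hw hM hb
  refine ⟨(fundConst n)⁻¹ * D, fun x hx => ?_⟩
  have hx0 : 0 < ‖x‖ := h0.trans_lt hx
  have hC := fundConst_ne_zero hn
  set r := b / ‖x‖ with hr
  have hr0 : 0 ≤ r := by positivity
  have hr1 : r < 1 := (div_lt_one hx0).2 hx
  have hf : Integrable (lap n w) := by
    simpa using integrable_mul_lap (g := fun _ => 1) continuous_const hw hb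
  let F (k : ℕ) (y : E n) : ℝ := ((‖x‖ ^ 2)⁻¹ ^ k * zonal n k x y) * lap n w y
  have hF (k : ℕ) : Integrable (F k) :=
    integrable_mul_lap (continuous_const.mul (contDiff_zonal_right (m := 2) k x).continuous) hw hb
  have hle (k : ℕ) : ∫ y, ‖F k y‖ ≤ zonalBound n r k * ∫ y, ‖lap n w y‖ := by
    rw [← integral_const_mul]
    refine integral_mono (hF k).norm (hf.norm.const_mul _) fun y => ?_
    by_cases hy : b < ‖y‖
    · simp [F, hb y hy]
    · simp only [F]
      rw [norm_mul]
      refine mul_le_mul_of_nonneg_right ?_ (norm_nonneg _)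
      refine abs_zonal_le hn (norm_pos_iff.1 hx0) ?_ k
      rw [hr, div_mul_cancel₀ _ hx0.ne']
      exact not_lt.1 hy
  have hsum : Summable fun k => ∫ y, ‖F k y‖ :=
    Summable.of_nonneg_of_le (fun k => integral_nonneg fun y => norm_nonneg _) hle
      ((summable_zonalBound hr0 hr1).mul_right _)
  have hs := hasSum_integral_of_summable_integral_norm hF hsum
  have ht (y : E n) : ∑' k, F k y
      = ‖x‖ ^ (2 * lam n) * ((‖x - y‖ ^ 2) ^ (-lam n) * lap n w y) := by
    by_cases hy : b < ‖y‖
    · simp [F, hb y hy]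
    · have := (hasSum_zonal ((not_lt.1 hy).trans_lt hx)).mul_right (lap n w y)
      rw [this.tsum_eq]
      ring
  simp only [ht] at hs
  rw [integral_const_mul] at hs
  have hs' := hs.mul_left ((fundConst n)⁻¹ * ‖x‖ ^ (-(2 * lam n)))
  have hterm (k : ℕ) : ‖x‖ ^ ((2 : ℝ) - n - 2 * k) * multipole n k w x
      = (fundConst n)⁻¹ * ‖x‖ ^ (-(2 * lam n)) * ∫ y, F k y := by
    have e : ‖x‖ ^ ((2 : ℝ) - n - 2 * k) = ‖x‖ ^ (-(2 * lam n)) * (‖x‖ ^ 2)⁻¹ ^ k := by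
      rw [inv_pow, ← pow_mul, ← Real.rpow_natCast, ← Real.rpow_neg hx0.le, ← Real.rpow_add hx0]
      congr 1
      simp [lam]
      ring
    simp only [F, mul_assoc, integral_const_mul]
    rw [e, multipole]
    ring
  have hval : w x - (fundConst n)⁻¹ * D = (fundConst n)⁻¹ * ‖x‖ ^ (-(2 * lam n))
      * (‖x‖ ^ (2 * lam n) * ∫ y, (‖x - y‖ ^ 2) ^ (-lam n) * lap n w y) := by
    have e : ‖x‖ ^ (-(2 * lam n)) * ‖x‖ ^ (2 * lam n) = 1 := by
      rw [← Real.rpow_add hx0, neg_add_cancel, Real.rpow_zero]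
    have e2 : w x = (fundConst n)⁻¹ * ((∫ y, (‖x - y‖ ^ 2) ^ (-lam n) * lap n w y) + D) := by
      rw [← hD x hx, inv_mul_cancel_left₀ hC]
    rw [e2]
    linear_combination (-(fundConst n)⁻¹ * ∫ y, (‖x - y‖ ^ 2) ^ (-lam n) * lap n w y) * e
  rw [funext hterm, hval]
  exact hs'

/-- A function harmonic and bounded outside a ball agrees, outside a larger ball, with a bounded
function on the whole space whose Laplacian has compact support. -/
lemma exists_extension {H : E n → ℝ} {ρ a b M : ℝ} (h0 : 0 ≤ ρ) (hρ : ρ < a) (hab : a < b)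
    (hreg : ContDiffOn ℝ 2 H {x : E n | ρ < ‖x‖}) (hharm : ∀ x : E n, ρ < ‖x‖ → lap n H x = 0)
    (hM : ∀ x : E n, ρ < ‖x‖ → |H x| ≤ M) :
    ∃ w : E n → ℝ, ContDiff ℝ 2 w ∧ (∀ y, |w y| ≤ |M|) ∧ (∀ y, b < ‖y‖ → lap n w y = 0) ∧
      ∀ y, b < ‖y‖ → w y = H y := by
  have hd : 0 < b ^ 2 - a ^ 2 := by nlinarith
  let χ (y : E n) : ℝ := Real.smoothTransition ((‖y‖ ^ 2 - a ^ 2) / (b ^ 2 - a ^ 2))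
  have hχ : ContDiff ℝ 2 χ := (Real.smoothTransition.contDiff (n := 2)).comp
    (((contDiff_id.norm_sq ℝ).sub contDiff_const).div_const _)
  have hχ0 (y : E n) (hy : ‖y‖ ≤ a) : χ y = 0 := by
    refine Real.smoothTransition.zero_of_nonpos (div_nonpos_of_nonpos_of_nonneg ?_ hd.le)
    rw [sub_nonpos]
    gcongr
  have hχ1 (y : E n) (hy : b ≤ ‖y‖) : χ y = 1 := by
    refine Real.smoothTransition.one_of_one_le ((one_le_div hd).2 ?_)
    have : 0 ≤ b := by linarith
    gcongr
  have hopen : IsOpen {x : E n | ρ < ‖x‖} := isOpen_lt continuous_const continuous_norm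
  have heq (y : E n) (hy : b < ‖y‖) : (fun y => χ y * H y) =ᶠ[𝓝 y] H := by
    filter_upwards [(isOpen_lt continuous_const continuous_norm).mem_nhds hy] with z hz
    rw [hχ1 z (le_of_lt hz), one_mul]
  refine ⟨fun y => χ y * H y, ?_, fun y => ?_, fun y hy => ?_, fun y hy => ?_⟩
  · rw [contDiff_iff_contDiffAt]
    intro y
    rcases lt_or_ge ρ ‖y‖ with hy | hy
    · exact hχ.contDiffAt.mul (hreg.contDiffAt (hopen.mem_nhds hy))
    · have : (fun y => χ y * H y) =ᶠ[𝓝 y] fun _ => 0 := by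
        filter_upwards [(isOpen_lt continuous_norm continuous_const).mem_nhds (hy.trans_lt hρ)]
          with z hz
        rw [hχ0 z (le_of_lt hz), zero_mul]
      exact contDiffAt_const.congr_of_eventuallyEq this
  · rcases lt_or_ge ρ ‖y‖ with hy | hy
    · rw [abs_mul, abs_of_nonneg (Real.smoothTransition.nonneg _)]
      exact (mul_le_of_le_one_left (abs_nonneg _) (Real.smoothTransition.le_one _)).trans
        ((hM y hy).trans (le_abs_self M))
    · simp [hχ0 y (by linarith)]
  · rw [lap_congr (heq y hy)]
    exact hharm y (by linarith)
  · exact (heq y hy).eq_of_nhds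

end Expansion

/-- expansion of bounded harmonic functions on `{|x| > 2}` in `ℝⁿ`, `n ≥ 3`. -/
theorem bounded_harmonic_expansion (n : ℕ) (hn : 3 ≤ n) (H : E n → ℝ)
    (hreg : ContDiffOn ℝ 2 H {x : E n | 2 < ‖x‖})
    (hharm : ∀ x : E n, 2 < ‖x‖ → lap n H x = 0)
    (hbdd : ∃ M : ℝ, ∀ x : E n, 2 < ‖x‖ → |H x| ≤ M) :
    ∃ (c : ℝ) (p : ℕ → (E n → ℝ)), (∀ k : ℕ, IsHHP n k (p k)) ∧
      ∀ x : E n, 2 < ‖x‖ →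
        Summable (fun k : ℕ => |‖x‖ ^ ((2:ℝ) - n - 2 * k) * p k x|) ∧
        H x = c + ∑' k : ℕ, ‖x‖ ^ ((2:ℝ) - n - 2 * k) * p k x := by
  obtain ⟨M, hM⟩ := hbdd
  obtain ⟨w, hw, hwM, hwl, hwH⟩ := exists_extension (a := 3) (b := 4) zero_le_two (by norm_num)
    (by norm_num) hreg hharm hM
  obtain ⟨c, hc⟩ := exists_hasSum_multipole hn hw (by norm_num) hwM hwl
  refine ⟨c, fun k => multipole n k w, isHHP_multipole hw hwl, fun x hx => ?_⟩
  suffices h : HasSum (fun k : ℕ => ‖x‖ ^ ((2 : ℝ) - n - 2 * k) * multipole n k w x) (H x - c) from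
    ⟨h.summable.abs, by rw [h.tsum_eq]; ring⟩
  obtain ⟨b, hb2, hbx⟩ := exists_between hx
  obtain ⟨a, ha2, hab⟩ := exists_between hb2
  obtain ⟨v, hv, hvM, hvl, hvH⟩ := exists_extension zero_le_two ha2 hab hreg hharm hM
  obtain ⟨d, hd⟩ := exists_hasSum_multipole hn hv (by linarith) hvM hvl
  have hvw (k : ℕ) (x : E n) : multipole n k v x = multipole n k w x :=
    multipole_congr hv hw hvl hwl (R := max b 4) (fun y hy => by
      rw [max_lt_iff] at hy
      rw [hvH y hy.1, hwH y hy.2]) k x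
  simp only [hvw] at hd
  have : NeZero n := ⟨by omega⟩
  obtain ⟨z, hz⟩ := NormedSpace.exists_lt_norm ℝ (E n) (max b 4)
  rw [max_lt_iff] at hz
  have hdc := (hd z hz.1).unique (hc z hz.2)
  rw [hvH z hz.1, hwH z hz.2] at hdc
  have h := hd x hbx
  rwa [hvH x hbx, sub_right_inj.1 hdc] at h
end
end

section
/- Let n ≥ 4, R ≥ 1 and q ∈ ℕ. Let A be a set of smooth functions on {x ∈ ℝⁿ : |x| ≥ R} such that SPAN(A) is closed under pointwise multiplication and every element of A is O(0). Let F : ℝ → ℝ be smooth and let f be a smooth function on {|x| ≥ R} with f = O(−(n−1)). If f has an expansion with terms in A up to order −q, then the function F∘f − F(0) also has an expansion with terms in A up to order −q. -/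
open Real
open scoped BigOperators

noncomputable section

/-- The exterior region `{x : ℝⁿ | R ≤ |x|}`. -/
def Sset (n : ℕ) (R : ℝ) : Set (E n) := {x : E n | R ≤ ‖x‖}

/-- `u = O(-q)` on `{|x| ≥ R}`: all rescaled iterated derivatives decay like `|x|^{-q}`. -/
def BigOh (n : ℕ) (R q : ℝ) (u : E n → ℝ) : Prop :=
  ∀ j : ℕ, ∃ C : ℝ, ∀ x ∈ Sset n R,
    ‖x‖ ^ j * ‖iteratedFDerivWithin ℝ j u (Sset n R) x‖ ≤ C * ‖x‖ ^ (-q)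

/-- `u` has an expansion with terms in `A` up to order `-q` on `{|x| ≥ R}`. -/
def HasExpansion (n : ℕ) (R : ℝ) (A : Set (E n → ℝ)) (q : ℝ) (u : E n → ℝ) : Prop :=
  ∃ ε : ℝ, ε ∈ Set.Ioo (0:ℝ) 1 ∧ ∃ v ∈ Submodule.span ℝ A,
    BigOh n R (q + ε) (fun x => u x - v x)

/-! ### The exterior region -/

theorem one_le_norm_of_mem_Sset {n : ℕ} {R : ℝ} (hR : 1 ≤ R) {x : E n} (hx : x ∈ Sset n R) :
    1 ≤ ‖x‖ :=
  hR.trans hx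

/-- Each point of the exterior region lies in a closed half-space contained in the region. -/
theorem uniqueDiffOn_Sset {n : ℕ} {R : ℝ} (hR : 1 ≤ R) : UniqueDiffOn ℝ (Sset n R) := by
  intro x hx
  have hx1 := one_le_norm_of_mem_Sset hR hx
  have hxpos : 0 < ‖x‖ := by linarith
  have hsub : {y : E n | ‖x‖ ^ 2 ≤ inner ℝ x y} ⊆ Sset n R := by
    intro y hy
    have h1 : ‖x‖ ^ 2 ≤ inner ℝ x y := hy
    have h2 := real_inner_le_norm x y
    have h3 : ‖x‖ ≤ ‖y‖ := le_of_mul_le_mul_left (by nlinarith) hxpos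
    exact le_trans hx h3
  refine UniqueDiffWithinAt.mono ?_ hsub
  refine uniqueDiffWithinAt_convex ?_ ?_ (subset_closure ?_)
  · exact convex_halfSpace_ge (innerSL ℝ x).isLinear _
  · refine ⟨(2 : ℝ) • x, ?_⟩
    have hopen : IsOpen {y : E n | ‖x‖ ^ 2 < inner ℝ x y} :=
      isOpen_lt continuous_const (by fun_prop)
    have hsub' : {y : E n | ‖x‖ ^ 2 < inner ℝ x y} ⊆ {y : E n | ‖x‖ ^ 2 ≤ inner ℝ x y} :=
      fun _ hy => le_of_lt hy.out
    refine interior_maximal hsub' hopen ?_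
    simp only [Set.mem_ofPred_eq, inner_smul_right, real_inner_self_eq_norm_sq]
    nlinarith
  · simp

/-! ### Symbol calculus for `BigOh` -/

/-- Smooth functions on the exterior region that are `O(-p)`. -/
def IsSymbol (n : ℕ) (R p : ℝ) (u : E n → ℝ) : Prop :=
  ContDiffOn ℝ (⊤ : ℕ∞) u (Sset n R) ∧ BigOh n R p u

section Symbol

variable {n : ℕ} {R p p' : ℝ} {u v : E n → ℝ}

theorem BigOh.congr (h : BigOh n R p u) (huv : Set.EqOn v u (Sset n R)) : BigOh n R p v := by
  intro j
  obtain ⟨C, hC⟩ := h j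
  refine ⟨C, fun x hx => ?_⟩
  rw [iteratedFDerivWithin_congr huv hx]
  exact hC x hx

theorem BigOh.mono (hR : 1 ≤ R) (h : BigOh n R p u) (hp : p' ≤ p) : BigOh n R p' u := by
  intro j
  obtain ⟨C, hC⟩ := h j
  refine ⟨|C|, fun x hx => (hC x hx).trans ?_⟩
  have hx1 := one_le_norm_of_mem_Sset hR hx
  calc C * ‖x‖ ^ (-p) ≤ |C| * ‖x‖ ^ (-p) := by gcongr; exact le_abs_self C
    _ ≤ |C| * ‖x‖ ^ (-p') := by
      gcongr

theorem IsSymbol.congr (h : IsSymbol n R p u) (huv : Set.EqOn v u (Sset n R)) :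
    IsSymbol n R p v :=
  ⟨h.1.congr huv, h.2.congr huv⟩

theorem IsSymbol.mono (hR : 1 ≤ R) (h : IsSymbol n R p u) (hp : p' ≤ p) : IsSymbol n R p' u :=
  ⟨h.1, h.2.mono hR hp⟩

theorem IsSymbol.zero : IsSymbol n R p (fun _ => 0) := by
  refine ⟨contDiffOn_const, fun j => ⟨0, fun x _ => ?_⟩⟩
  simp

theorem IsSymbol.add (hR : 1 ≤ R) (hu : IsSymbol n R p u) (hv : IsSymbol n R p v) :
    IsSymbol n R p (fun x => u x + v x) := by
  refine ⟨hu.1.add hv.1, fun j => ?_⟩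
  obtain ⟨C, hC⟩ := hu.2 j
  obtain ⟨C', hC'⟩ := hv.2 j
  refine ⟨C + C', fun x hx => ?_⟩
  have hj : (j : WithTop ℕ∞) ≤ ((⊤ : ℕ∞) : WithTop ℕ∞) := by exact_mod_cast le_top
  rw [fun_iteratedFDerivWithin_add_apply ((hu.1.of_le hj) x hx) ((hv.1.of_le hj) x hx)
    (uniqueDiffOn_Sset hR) hx]
  calc _ ≤ ‖x‖ ^ j * (‖iteratedFDerivWithin ℝ j u (Sset n R) x‖
        + ‖iteratedFDerivWithin ℝ j v (Sset n R) x‖) := by gcongr; exact norm_add_le _ _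
    _ ≤ _ := by linarith [hC x hx, hC' x hx]

theorem IsSymbol.const_mul (hR : 1 ≤ R) (c : ℝ) (hu : IsSymbol n R p u) :
    IsSymbol n R p (fun x => c * u x) := by
  refine ⟨contDiffOn_const.mul hu.1, fun j => ?_⟩
  obtain ⟨C, hC⟩ := hu.2 j
  refine ⟨|c| * C, fun x hx => ?_⟩
  have hj : (j : WithTop ℕ∞) ≤ ((⊤ : ℕ∞) : WithTop ℕ∞) := by exact_mod_cast le_top
  have h : iteratedFDerivWithin ℝ j (fun x => c * u x) (Sset n R) x
      = c • iteratedFDerivWithin ℝ j u (Sset n R) x :=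
    iteratedFDerivWithin_const_smul_apply (a := c) ((hu.1.of_le hj) x hx) (uniqueDiffOn_Sset hR) hx
  rw [h, norm_smul, Real.norm_eq_abs]
  nlinarith [mul_le_mul_of_nonneg_left (hC x hx) (abs_nonneg c)]

theorem IsSymbol.sub (hR : 1 ≤ R) (hu : IsSymbol n R p u) (hv : IsSymbol n R p v) :
    IsSymbol n R p (fun x => u x - v x) :=
  (hu.add hR (hv.const_mul hR (-1))).congr fun x _ => by ring

theorem IsSymbol.mul (hR : 1 ≤ R) (hu : IsSymbol n R p u) (hv : IsSymbol n R p' v) :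
    IsSymbol n R (p + p') (fun x => u x * v x) := by
  refine ⟨hu.1.mul hv.1, fun j => ?_⟩
  choose C hC using hu.2
  choose C' hC' using hv.2
  refine ⟨∑ i ∈ Finset.range (j + 1), (j.choose i : ℝ) * C i * C' (j - i), fun x hx => ?_⟩
  have hxpos : 0 < ‖x‖ := lt_of_lt_of_le one_pos (one_le_norm_of_mem_Sset hR hx)
  have hj : (j : WithTop ℕ∞) ≤ ((⊤ : ℕ∞) : WithTop ℕ∞) := by exact_mod_cast le_top
  refine (mul_le_mul_of_nonneg_left
    (norm_iteratedFDerivWithin_mul_le hu.1 hv.1 (uniqueDiffOn_Sset hR) hx hj)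
    (by positivity)).trans ?_
  rw [Finset.mul_sum, Finset.sum_mul]
  refine Finset.sum_le_sum fun i hi => ?_
  have hij : i ≤ j := Nat.lt_succ_iff.mp (Finset.mem_range.mp hi)
  have hprod := mul_le_mul (hC i x hx) (hC' (j - i) x hx) (by positivity)
    ((by positivity : (0:ℝ) ≤ _).trans (hC i x hx))
  calc _ = (j.choose i : ℝ) * ((‖x‖ ^ i * ‖iteratedFDerivWithin ℝ i u (Sset n R) x‖)
        * (‖x‖ ^ (j - i) * ‖iteratedFDerivWithin ℝ (j - i) v (Sset n R) x‖)) := by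
        rw [show ‖x‖ ^ j = ‖x‖ ^ i * ‖x‖ ^ (j - i) by rw [← pow_add, Nat.add_sub_cancel' hij]]
        ring
    _ ≤ (j.choose i : ℝ) * ((C i * ‖x‖ ^ (-p)) * (C' (j - i) * ‖x‖ ^ (-p'))) := by gcongr
    _ = _ := by
        rw [show -(p + p') = -p + -p' by ring, Real.rpow_add hxpos]
        ring

theorem IsSymbol.pow_succ (hR : 1 ≤ R) (hu : IsSymbol n R p u) (N : ℕ) :
    IsSymbol n R ((N + 1 : ℝ) * p) (fun x => u x ^ (N + 1)) := by
  induction N with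
  | zero => simpa using hu
  | succ N ih =>
    have h := ih.mul hR hu
    rw [show (N + 1 : ℝ) * p + p = ((N + 1 : ℕ) + 1 : ℝ) * p by push_cast; ring] at h
    exact h.congr fun x _ => by ring

/-- Smooth functions of bounded symbols are bounded symbols. -/
theorem IsSymbol.comp (hR : 1 ≤ R) {F : ℝ → ℝ} (hF : ContDiff ℝ (⊤ : ℕ∞) F)
    (hu : IsSymbol n R 0 u) : IsSymbol n R 0 (fun x => F (u x)) := by
  refine ⟨hF.comp_contDiffOn hu.1, fun j => ?_⟩
  choose C hC using hu.2
  have hj : ∀ i : ℕ, (i : WithTop ℕ∞) ≤ ((⊤ : ℕ∞) : WithTop ℕ∞) :=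
    fun i => by exact_mod_cast le_top
  have hbdd : ∀ i : ℕ, ∃ B : ℝ, ∀ t ∈ Set.Icc (-C 0) (C 0), ‖iteratedFDeriv ℝ i F t‖ ≤ B :=
    fun i => isCompact_Icc.exists_bound_of_continuousOn
      (hF.continuous_iteratedFDeriv (hj i)).continuousOn
  choose B hB using hbdd
  have hxpos : ∀ x ∈ Sset n R, 0 < ‖x‖ := fun x hx =>
    lt_of_lt_of_le one_pos (one_le_norm_of_mem_Sset hR hx)
  set M : ℝ := ∑ i ∈ Finset.range (j + 1), |B i|
  set K : ℝ := 1 + ∑ i ∈ Finset.range (j + 1), |C i|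
  have hK : 1 ≤ K := le_add_of_nonneg_right (Finset.sum_nonneg fun i _ => abs_nonneg _)
  refine ⟨(Nat.factorial j : ℝ) * M * K ^ j, fun x hx => ?_⟩
  have hx0 := hxpos x hx
  have hmem : u x ∈ Set.Icc (-C 0) (C 0) := by
    have h := hC 0 x hx
    simp only [pow_zero, one_mul, norm_iteratedFDerivWithin_zero, neg_zero, Real.rpow_zero,
      mul_one, Real.norm_eq_abs] at h
    exact abs_le.mp h
  have key := norm_iteratedFDerivWithin_comp_le (n := j) (C := M) (D := K / ‖x‖)
    hF.contDiffOn hu.1 (hj j) uniqueDiffOn_univ (uniqueDiffOn_Sset hR) (Set.mapsTo_univ _ _) hx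
    (fun i hi => by
      rw [iteratedFDerivWithin_univ]
      refine (hB i _ hmem).trans ((le_abs_self _).trans ?_)
      exact Finset.single_le_sum (f := fun i => |B i|) (fun i _ => abs_nonneg _)
        (Finset.mem_range.mpr (Nat.lt_succ_of_le hi)))
    (fun i h1 hi => by
      have h := hC i x hx
      simp only [neg_zero, Real.rpow_zero, mul_one] at h
      have hCK : C i ≤ K := by
        have := Finset.single_le_sum (f := fun i => |C i|) (fun i _ => abs_nonneg _)
          (Finset.mem_range.mpr (Nat.lt_succ_of_le hi))
        have := le_abs_self (C i)
        simp only [K]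
        linarith
      rw [div_pow, le_div_iff₀ (by positivity), mul_comm]
      exact h.trans (hCK.trans (le_self_pow₀ hK (by omega))))
  calc _ ≤ ‖x‖ ^ j * ((Nat.factorial j : ℝ) * M * (K / ‖x‖) ^ j) := by gcongr; exact key
    _ = _ := by
      simp only [neg_zero, Real.rpow_zero, mul_one]
      rw [div_pow]
      field_simp

end Symbol

/-! ### Hadamard's lemma -/

section Hadamard

open MeasureTheory Filter Topology

theorem hasDerivAt_integral_pow_mul_comp_mul {G : ℝ → ℝ} (hG : ContDiff ℝ 1 G) (k : ℕ) (t : ℝ) :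
    HasDerivAt (fun t => ∫ s in (0:ℝ)..1, s ^ k * G (s * t))
      (∫ s in (0:ℝ)..1, s ^ (k + 1) * deriv G (s * t)) t := by
  have hGc : Continuous G := hG.continuous
  have hG'c : Continuous (deriv G) := hG.continuous_deriv le_rfl
  have hcont : Continuous fun y : ℝ × ℝ => y.2 ^ (k + 1) * deriv G (y.2 * y.1) := by fun_prop
  obtain ⟨B, hB⟩ := (isCompact_Icc.prod isCompact_Icc).exists_bound_of_continuousOn
    (s := Set.Icc (t - 1) (t + 1) ×ˢ Set.Icc (0:ℝ) 1) hcont.continuousOn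
  refine (intervalIntegral.hasDerivAt_integral_of_dominated_loc_of_deriv_le
    (F := fun t s => s ^ k * G (s * t)) (F' := fun t s => s ^ (k + 1) * deriv G (s * t))
    (s := Set.Icc (t - 1) (t + 1)) (bound := fun _ => B)
    (Icc_mem_nhds (by linarith) (by linarith)) ?_ ?_ ?_ ?_ ?_ ?_).2
  · exact Eventually.of_forall fun x =>
      (by fun_prop : Continuous fun s : ℝ => s ^ k * G (s * x)).aestronglyMeasurable
  · exact (by fun_prop : Continuous fun s : ℝ => s ^ k * G (s * t)).intervalIntegrable _ _
  · exact (by fun_prop : Continuous fun s : ℝ =>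
      s ^ (k + 1) * deriv G (s * t)).aestronglyMeasurable
  · refine Eventually.of_forall fun s hs x hx => hB (x, s) ⟨hx, ?_⟩
    rw [Set.uIoc_of_le zero_le_one] at hs
    exact Set.Ioc_subset_Icc_self hs
  · exact intervalIntegrable_const
  · refine Eventually.of_forall fun s _ x _ => ?_
    have hd : HasDerivAt G (deriv G (s * x)) (s * x) :=
      (hG.differentiable one_ne_zero _).hasDerivAt
    have h := (hd.comp x ((hasDerivAt_id x).const_mul s)).const_mul (s ^ k)
    rwa [show s ^ k * (deriv G (s * x) * (s * 1)) = s ^ (k + 1) * deriv G (s * x) by ring] at h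

theorem contDiff_integral_pow_mul_comp_mul {G : ℝ → ℝ} (hG : ContDiff ℝ (⊤ : ℕ∞) G) (k : ℕ) :
    ContDiff ℝ (⊤ : ℕ∞) (fun t => ∫ s in (0:ℝ)..1, s ^ k * G (s * t)) := by
  refine contDiff_infty.mpr fun m => ?_
  induction m generalizing G k with
  | zero =>
    refine contDiff_zero.mpr (continuous_iff_continuousAt.mpr fun t => ?_)
    exact (hasDerivAt_integral_pow_mul_comp_mul (hG.of_le (by exact_mod_cast le_top)) k
      t).continuousAt
  | succ m ih =>
    have hd := hasDerivAt_integral_pow_mul_comp_mul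
      (hG.of_le (by exact_mod_cast le_top : (1 : WithTop ℕ∞) ≤ ((⊤ : ℕ∞) : WithTop ℕ∞))) k
    push_cast
    refine contDiff_succ_iff_deriv.mpr ⟨fun t => (hd t).differentiableAt, by simp, ?_⟩
    rw [funext fun t => (hd t).deriv]
    exact ih (contDiff_infty_iff_deriv.mp hG).2 (k + 1)

/-- Hadamard's lemma in one variable. -/
theorem exists_contDiff_eq_add_mul {G : ℝ → ℝ} (hG : ContDiff ℝ (⊤ : ℕ∞) G) :
    ∃ H : ℝ → ℝ, ContDiff ℝ (⊤ : ℕ∞) H ∧ ∀ t, G t = G 0 + t * H t := by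
  have hG' := contDiff_infty_iff_deriv.mp hG
  refine ⟨_, contDiff_integral_pow_mul_comp_mul hG'.2 0, fun t => ?_⟩
  have hint : ∫ s in (0:ℝ)..1, deriv G (s * t) * t = G (1 * t) - G (0 * t) := by
    refine intervalIntegral.integral_eq_sub_of_hasDerivAt (f := fun s => G (s * t))
      (fun s _ => ?_) ?_
    · have h := (hG'.1 (s * t)).hasDerivAt.comp s ((hasDerivAt_id s).mul_const t)
      simpa only [id_eq, one_mul, Function.comp_def] using h
    · have := hG'.2.continuous
      exact (by fun_prop : Continuous fun s : ℝ => deriv G (s * t) * t).intervalIntegrable _ _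
  rw [intervalIntegral.integral_mul_const] at hint
  simp only [one_mul, zero_mul] at hint
  simp only [pow_zero, one_mul]
  linarith

end Hadamard

/-! ### Functions with an expansion -/

section Expansion

variable {n : ℕ} {R p : ℝ} {A : Set (E n → ℝ)} {u v : E n → ℝ}

theorem IsSymbol.of_mem_span (hR : 1 ≤ R) (hA : ∀ a ∈ A, IsSymbol n R p a)
    (hu : u ∈ Submodule.span ℝ A) : IsSymbol n R p u := by
  induction hu using Submodule.span_induction with
  | mem a ha => exact hA a ha
  | zero => exact IsSymbol.zero
  | add a b _ _ ha hb => exact ha.add hR hb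
  | smul c a _ ha => exact ha.const_mul hR c

/-- Bounded symbols agreeing with an element of the span of `A` modulo symbols `O(-p)`. -/
def IsExpandable (n : ℕ) (R : ℝ) (A : Set (E n → ℝ)) (p : ℝ) (u : E n → ℝ) : Prop :=
  IsSymbol n R 0 u ∧ ∃ v ∈ Submodule.span ℝ A, IsSymbol n R p (fun x => u x - v x)

theorem IsExpandable.congr (hu : IsExpandable n R A p u) (huv : Set.EqOn v u (Sset n R)) :
    IsExpandable n R A p v := by
  obtain ⟨hu0, w, hw, huw⟩ := hu
  exact ⟨hu0.congr huv, w, hw, huw.congr fun x hx => by simp only [huv hx]⟩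

theorem IsSymbol.isExpandable (hR : 1 ≤ R) (hp : 0 ≤ p) (hu : IsSymbol n R p u) :
    IsExpandable n R A p u :=
  ⟨hu.mono hR hp, 0, zero_mem _, hu.congr fun x _ => by simp⟩

theorem IsExpandable.add (hR : 1 ≤ R) (hu : IsExpandable n R A p u)
    (hv : IsExpandable n R A p v) : IsExpandable n R A p (fun x => u x + v x) := by
  obtain ⟨hu0, a, ha, hua⟩ := hu
  obtain ⟨hv0, b, hb, hvb⟩ := hv
  refine ⟨hu0.add hR hv0, a + b, add_mem ha hb, (hua.add hR hvb).congr fun x _ => ?_⟩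
  simp only [Pi.add_apply]
  ring

theorem IsExpandable.const_mul (hR : 1 ≤ R) (c : ℝ) (hu : IsExpandable n R A p u) :
    IsExpandable n R A p (fun x => c * u x) := by
  obtain ⟨hu0, a, ha, hua⟩ := hu
  refine ⟨hu0.const_mul hR c, c • a, Submodule.smul_mem _ c ha,
    (hua.const_mul hR c).congr fun x _ => ?_⟩
  simp only [Pi.smul_apply, smul_eq_mul]
  ring

theorem IsExpandable.mul (hR : 1 ≤ R) (hA : ∀ a ∈ A, IsSymbol n R 0 a)
    (hAmul : ∀ u ∈ Submodule.span ℝ A, ∀ v ∈ Submodule.span ℝ A,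
      ∃ w ∈ Submodule.span ℝ A, ∀ x ∈ Sset n R, u x * v x = w x)
    (hu : IsExpandable n R A p u) (hv : IsExpandable n R A p v) :
    IsExpandable n R A p (fun x => u x * v x) := by
  obtain ⟨hu0, a, ha, hua⟩ := hu
  obtain ⟨hv0, b, hb, hvb⟩ := hv
  obtain ⟨w, hw, hab⟩ := hAmul a ha b hb
  have h1 := hua.mul hR hv0
  have h2 := hvb.mul hR (IsSymbol.of_mem_span hR hA ha)
  rw [add_zero] at h1 h2
  refine ⟨by simpa using hu0.mul hR hv0, w, hw, (h1.add hR h2).congr fun x hx => ?_⟩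
  simp only [← hab x hx]
  ring

theorem IsExpandable.pow_succ (hR : 1 ≤ R) (hA : ∀ a ∈ A, IsSymbol n R 0 a)
    (hAmul : ∀ u ∈ Submodule.span ℝ A, ∀ v ∈ Submodule.span ℝ A,
      ∃ w ∈ Submodule.span ℝ A, ∀ x ∈ Sset n R, u x * v x = w x)
    (hu : IsExpandable n R A p u) (N : ℕ) :
    IsExpandable n R A p (fun x => u x ^ (N + 1)) := by
  induction N with
  | zero => simpa using hu
  | succ N ih => exact (ih.mul hR hA hAmul hu).congr fun x _ => by ring

/-- Taylor expansion of a smooth function composed with an expandable symbol. -/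
theorem IsExpandable.exists_taylor (hR : 1 ≤ R) (hp : 0 ≤ p) (hA : ∀ a ∈ A, IsSymbol n R 0 a)
    (hAmul : ∀ u ∈ Submodule.span ℝ A, ∀ v ∈ Submodule.span ℝ A,
      ∃ w ∈ Submodule.span ℝ A, ∀ x ∈ Sset n R, u x * v x = w x)
    (hu : IsExpandable n R A p u) {F : ℝ → ℝ} (hF : ContDiff ℝ (⊤ : ℕ∞) F) (N : ℕ) :
    ∃ H : ℝ → ℝ, ContDiff ℝ (⊤ : ℕ∞) H ∧
      IsExpandable n R A p (fun x => F (u x) - F 0 - u x ^ (N + 1) * H (u x)) := by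
  induction N with
  | zero =>
    obtain ⟨H, hH, hFH⟩ := exists_contDiff_eq_add_mul hF
    refine ⟨H, hH, (IsSymbol.zero.isExpandable hR hp).congr fun x _ => ?_⟩
    simp only [hFH (u x)]
    ring
  | succ N ih =>
    obtain ⟨H, hH, hexp⟩ := ih
    obtain ⟨K, hK, hHK⟩ := exists_contDiff_eq_add_mul hH
    refine ⟨K, hK, (hexp.add hR ((hu.pow_succ hR hA hAmul N).const_mul hR (H 0))).congr
      fun x _ => ?_⟩
    simp only [hHK (u x)]
    ring

end Expansion

/-- composition with a smooth function preserves expansions. -/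
theorem composition_has_expansion (n : ℕ) (hn : 4 ≤ n) (R : ℝ) (hR : 1 ≤ R) (q : ℕ)
    (A : Set (E n → ℝ))
    (hAsmooth : ∀ a ∈ A, ContDiffOn ℝ (⊤ : ℕ∞) a (Sset n R))
    (hAO : ∀ a ∈ A, BigOh n R 0 a)
    (hAmul : ∀ u ∈ Submodule.span ℝ A, ∀ v ∈ Submodule.span ℝ A,
      ∃ w ∈ Submodule.span ℝ A, ∀ x ∈ Sset n R, u x * v x = w x)
    (F : ℝ → ℝ) (hF : ContDiff ℝ (⊤ : ℕ∞) F)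
    (f : E n → ℝ) (hfsmooth : ContDiffOn ℝ (⊤ : ℕ∞) f (Sset n R))
    (hfO : BigOh n R ((n:ℝ) - 1) f)
    (hfexp : HasExpansion n R A q f) :
    HasExpansion n R A q (fun x => F (f x) - F 0) := by
  obtain ⟨ε, hε, v, hv, hfv⟩ := hfexp
  have hA : ∀ a ∈ A, IsSymbol n R 0 a := fun a ha => ⟨hAsmooth a ha, hAO a ha⟩
  have hn4 : (4:ℝ) ≤ n := by exact_mod_cast hn
  have hp : 0 ≤ (q:ℝ) + ε := add_nonneg q.cast_nonneg hε.1.le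
  have hf : IsSymbol n R ((n:ℝ) - 1) f := ⟨hfsmooth, hfO⟩
  have hf0 : IsSymbol n R 0 f := hf.mono hR (by linarith)
  have hfX : IsExpandable n R A (q + ε) f :=
    ⟨hf0, v, hv, hfsmooth.sub (IsSymbol.of_mem_span hR hA hv).1, hfv⟩
  obtain ⟨H, hH, hexp⟩ := hfX.exists_taylor hR hp hA hAmul hF q
  have hrem := (hf.pow_succ hR q).mul hR (hf0.comp hR hH)
  have hle : (q:ℝ) + ε ≤ (q + 1 : ℝ) * ((n:ℝ) - 1) + 0 := by
    nlinarith [hε.2, (q.cast_nonneg : (0:ℝ) ≤ q)]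
  obtain ⟨-, w, hw, hFw⟩ := hexp.add hR ((hrem.mono hR hle).isExpandable hR hp)
  refine ⟨ε, hε, w, hw, hFw.2.congr fun x _ => ?_⟩
  ring
end
end
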